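/- arXiv:2110.14391 — 10 statements merged into one kernel-verified Lean document; each statement's English description precedes it below -/
import Mathlib

section
/- Let x be a unit vector in ℝ^d with ⟨x, v₁⟩ ≥ a for some a > 0 and x ≠ v₁. Then the function f(x) = −xᵀAx is 2a-weakly-quasi-convex at x with respect to the minimizer v₁: 2a·(f(x) − f*) ≤ ⟨grad f(x), −log_x(v₁)⟩, where f* = −λ₁. -/
open RealInnerProductSpace

/-- The Riemannian logarithm map on the unit sphere:
`log_x(y) = arccos⟨y,x⟩ · P_x(y−x)/‖P_x(y−x)‖` with `P_x = I − xxᵀ`. -/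
noncomputable def sphereLog {d : ℕ} (x y : EuclideanSpace ℝ (Fin d)) :
    EuclideanSpace ℝ (Fin d) :=
  Real.arccos ⟪y, x⟫ •
    (‖(y - x) - ⟪y - x, x⟫ • x‖⁻¹ • ((y - x) - ⟪y - x, x⟫ • x))

/-- `f(x) = −xᵀAx` is `2a`-weakly-quasi-convex at any unit vector `x`
with `⟨x, v₁⟩ ≥ a > 0`, `x ≠ v₁`, with respect to the minimizer `v₁`:
`2a·(f(x) − f*) ≤ ⟨grad f(x), −log_x(v₁)⟩` where `f* = −λ₁` and
`grad f(x) = 2(xᵀAx)x − 2Ax`. -/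
theorem stmt_0 {d : ℕ} (hd : 2 ≤ d)
    (A : EuclideanSpace ℝ (Fin d) →ₗ[ℝ] EuclideanSpace ℝ (Fin d))
    (hsymm : ∀ u w, ⟪A u, w⟫ = ⟪u, A w⟫)
    (hpsd : ∀ u, 0 ≤ ⟪u, A u⟫)
    (v₁ : EuclideanSpace ℝ (Fin d)) (l₁ : ℝ)
    (hv₁ : ‖v₁‖ = 1) (hAv₁ : A v₁ = l₁ • v₁)
    (hmax : ∀ u : EuclideanSpace ℝ (Fin d), ‖u‖ = 1 → ⟪u, A u⟫ ≤ l₁)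
    (a : ℝ) (ha : 0 < a)
    (x : EuclideanSpace ℝ (Fin d)) (hx : ‖x‖ = 1)
    (hxa : a ≤ ⟪x, v₁⟫) (hne : x ≠ v₁) :
    2 * a * ((-⟪x, A x⟫) - (-l₁)) ≤
      ⟪(2 * ⟪x, A x⟫) • x - (2 : ℝ) • A x, -sphereLog x v₁⟫ := by
  set c : ℝ := ⟪v₁, x⟫ with hc
  set q : ℝ := ⟪x, A x⟫ with hq
  have hxv : ⟪x, v₁⟫ = c := real_inner_comm _ _
  have hxx : ⟪x, x⟫ = 1 := by rw [real_inner_self_eq_norm_sq, hx]; norm_num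
  have hvv : ⟪v₁, v₁⟫ = 1 := by rw [real_inner_self_eq_norm_sq, hv₁]; norm_num
  have hAxx : ⟪A x, x⟫ = q := hsymm x x
  have hAxv : ⟪A x, v₁⟫ = l₁ * c := by
    rw [hsymm, hAv₁, real_inner_smul_right, hxv]
  rw [hxv] at hxa
  have hc1 : c < 1 := hxv ▸ (inner_lt_one_iff_real_of_norm_eq_one hx hv₁).2 hne
  have hw : (v₁ - x) - ⟪v₁ - x, x⟫ • x = v₁ - c • x := by
    rw [inner_sub_left, hxx, ← hc]
    module
  have hwsq : ‖v₁ - c • x‖ ^ 2 = 1 - c ^ 2 := by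
    rw [← real_inner_self_eq_norm_sq]
    simp only [inner_sub_left, inner_sub_right, real_inner_smul_left, real_inner_smul_right,
      hxx, hvv, hxv, ← hc]
    ring
  have hwpos : 0 < ‖v₁ - c • x‖ :=
    (norm_nonneg _).lt_of_ne fun h => by rw [← h] at hwsq; nlinarith
  have hwarc : ‖v₁ - c • x‖ ≤ Real.arccos c := by
    rw [← Real.sqrt_sq hwpos.le, hwsq, ← Real.sin_arccos]
    exact Real.sin_le (Real.arccos_nonneg c)
  have hratio : 1 ≤ Real.arccos c * ‖v₁ - c • x‖⁻¹ := by
    rw [← div_eq_mul_inv]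
    exact (one_le_div hwpos).2 hwarc
  have hgrad : ⟪(2 * q) • x - (2 : ℝ) • A x, -sphereLog x v₁⟫ =
      Real.arccos c * ‖v₁ - c • x‖⁻¹ * (2 * c * (l₁ - q)) := by
    rw [sphereLog, hw, ← hc]
    simp only [inner_neg_right, real_inner_smul_right]
    simp only [inner_sub_left, inner_sub_right, real_inner_smul_left, real_inner_smul_right,
      hxx, hxv, hAxx, hAxv]
    ring
  have hgap : 0 ≤ l₁ - q := sub_nonneg.2 (hmax x hx)
  rw [hgrad]
  calc 2 * a * (-q - -l₁) = 2 * a * (l₁ - q) := by ring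
    _ ≤ 2 * c * (l₁ - q) := by gcongr
    _ ≤ _ := le_mul_of_one_le_left
      (mul_nonneg (mul_nonneg zero_le_two (ha.le.trans hxa)) hgap) hratio
end

section
/- For every unit vector x in ℝ^d, the identity ⟨(I − xxᵀ)(−2Ax), x − v₁⟩ = 2·⟨x, v₁⟩·(λ₁ − xᵀAx) holds; in particular, if A is positive semidefinite with largest eigenvalue λ₁ this inner product equals 2⟨x,v₁⟩(f(x) − f*) ≥ 0 whenever ⟨x,v₁⟩ ≥ 0. -/
open RealInnerProductSpace

/-- for every unit vector `x`,
`⟨(I − xxᵀ)(−2Ax), x − v₁⟩ = 2⟨x,v₁⟩(λ₁ − xᵀAx)`; in particular, since this equals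
`2⟨x,v₁⟩(f(x) − f*)` with `f(x) = −xᵀAx`, `f* = −λ₁`, it is nonnegative whenever
`⟨x,v₁⟩ ≥ 0`. -/
theorem stmt_1 {d : ℕ} (hd : 2 ≤ d)
    (A : EuclideanSpace ℝ (Fin d) →ₗ[ℝ] EuclideanSpace ℝ (Fin d))
    (hsymm : ∀ u w, ⟪A u, w⟫ = ⟪u, A w⟫)
    (hpsd : ∀ u, 0 ≤ ⟪u, A u⟫)
    (v₁ : EuclideanSpace ℝ (Fin d)) (l₁ : ℝ)
    (hv₁ : ‖v₁‖ = 1) (hAv₁ : A v₁ = l₁ • v₁)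
    (hmax : ∀ u : EuclideanSpace ℝ (Fin d), ‖u‖ = 1 → ⟪u, A u⟫ ≤ l₁)
    (x : EuclideanSpace ℝ (Fin d)) (hx : ‖x‖ = 1) :
    ⟪((-2 : ℝ) • A x) - ⟪(-2 : ℝ) • A x, x⟫ • x, x - v₁⟫
        = 2 * ⟪x, v₁⟫ * (l₁ - ⟪x, A x⟫) ∧
    (0 ≤ ⟪x, v₁⟫ →
      0 ≤ ⟪((-2 : ℝ) • A x) - ⟪(-2 : ℝ) • A x, x⟫ • x, x - v₁⟫) := by
  have hxx : ⟪x, x⟫ = 1 := by rw [real_inner_self_eq_norm_sq, hx, one_pow]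
  have hxv : ⟪A x, v₁⟫ = l₁ * ⟪x, v₁⟫ := by rw [hsymm, hAv₁, real_inner_smul_right]
  have key : ⟪((-2 : ℝ) • A x) - ⟪(-2 : ℝ) • A x, x⟫ • x, x - v₁⟫
      = 2 * ⟪x, v₁⟫ * (l₁ - ⟪x, A x⟫) := by
    simp only [inner_sub_left, inner_sub_right, real_inner_smul_left, hxx, hxv, hsymm x x]
    ring
  refine ⟨key, fun h => ?_⟩
  rw [key]
  exact mul_nonneg (mul_nonneg zero_le_two h) (sub_nonneg.2 (hmax x hx))
end

section
/- Let x be a unit vector in ℝ^d with ⟨x, v₁⟩ ≥ 0. Then the function f(x) = −xᵀAx satisfies the quadratic growth condition f(x) − f* ≥ (δ/4)·dist²(x, v₁), i.e. λ₁ − xᵀAx ≥ (δ/4)·(arccos⟨x, v₁⟩)². -/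
open RealInnerProductSpace

/-- A unit-sphere bound on the quadratic form of `A` over the orthogonal complement of `v` extends
by homogeneity to the whole complement. -/
theorem inner_map_self_le_mul_norm_sq_of_orthogonal {E : Type*} [NormedAddCommGroup E]
    [InnerProductSpace ℝ E] {A : E →ₗ[ℝ] E} {v : E} {l : ℝ}
    (h : ∀ w : E, ‖w‖ = 1 → ⟪w, v⟫ = 0 → ⟪w, A w⟫ ≤ l) {w : E} (hw : ⟪w, v⟫ = 0) :
    ⟪w, A w⟫ ≤ l * ‖w‖ ^ 2 := by
  rcases eq_or_ne w 0 with rfl | hw0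
  · simp
  · have hpos : 0 < ‖w‖ := norm_pos_iff.2 hw0
    have key := h (‖w‖⁻¹ • w) (by simp [norm_smul, hpos.ne'])
      (by simp [real_inner_smul_left, hw])
    rw [map_smul, real_inner_smul_left, real_inner_smul_right] at key
    have hmul := mul_le_mul_of_nonneg_right key (sq_nonneg ‖w‖)
    field_simp at hmul
    linarith

/-- The Rayleigh quotient deficit at `x` is at least the eigengap times the squared sine of the
angle between `x` and the leading eigenvector. -/
theorem eigengap_mul_one_sub_inner_sq_le {E : Type*} [NormedAddCommGroup E]
    [InnerProductSpace ℝ E] {A : E →ₗ[ℝ] E} (hsymm : ∀ u w, ⟪A u, w⟫ = ⟪u, A w⟫)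
    {v x : E} {l₁ l₂ : ℝ} (hv : ‖v‖ = 1) (hAv : A v = l₁ • v)
    (h : ∀ w : E, ‖w‖ = 1 → ⟪w, v⟫ = 0 → ⟪w, A w⟫ ≤ l₂) (hx : ‖x‖ = 1) :
    (l₁ - l₂) * (1 - ⟪x, v⟫ ^ 2) ≤ l₁ - ⟪x, A x⟫ := by
  have hvv : ⟪v, v⟫ = 1 := by rw [real_inner_self_eq_norm_sq, hv, one_pow]
  have hxx : ⟪x, x⟫ = 1 := by rw [real_inner_self_eq_norm_sq, hx, one_pow]
  have hvx : ⟪v, x⟫ = ⟪x, v⟫ := real_inner_comm x v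
  have hvAx : ⟪v, A x⟫ = l₁ * ⟪x, v⟫ := by
    rw [← hsymm, hAv, real_inner_smul_left, hvx]
  have horth : ⟪x - ⟪x, v⟫ • v, v⟫ = 0 := by
    rw [inner_sub_left, real_inner_smul_left, hvv, mul_one, sub_self]
  have hle := inner_map_self_le_mul_norm_sq_of_orthogonal h horth
  rw [← real_inner_self_eq_norm_sq] at hle
  simp only [map_sub, map_smul, hAv, inner_sub_left, inner_sub_right, real_inner_smul_left,
    real_inner_smul_right, hvv, hxx, hvx, hvAx] at hle
  linarith

/-- On `[0, 1]`, the squared arccosine is at most `4 (1 - c ^ 2)`. -/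
theorem arccos_sq_div_four_le {c : ℝ} (h₀ : 0 ≤ c) (h₁ : c ≤ 1) :
    Real.arccos c ^ 2 / 4 ≤ 1 - c ^ 2 := by
  have hθ := Real.arccos_nonneg c
  have hsin := Real.mul_le_sin hθ (Real.arccos_le_pi_div_two.2 h₀)
  have hhalf : 1 / 2 ≤ 2 / Real.pi := by
    rw [div_le_div_iff₀ two_pos Real.pi_pos]
    linarith [Real.pi_le_four]
  have hle : Real.arccos c / 2 ≤ Real.sin (Real.arccos c) := by
    linarith [mul_le_mul_of_nonneg_right hhalf hθ]
  have hsq := pow_le_pow_left₀ (by positivity) hle 2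
  rw [Real.sin_sq, Real.cos_arccos (by linarith) h₁] at hsq
  linarith

/-- quadratic growth. For a unit vector `x` with `⟨x,v₁⟩ ≥ 0`,
the function `f(x) = −xᵀAx` (with minimum `f* = −λ₁`) satisfies
`f(x) − f* ≥ (δ/4)·dist²(x,v₁)`, i.e. `λ₁ − xᵀAx ≥ (δ/4)·(arccos⟨x,v₁⟩)²`,
where `δ = λ₁ − λ₂ > 0`. -/
theorem stmt_5 {d : ℕ} (hd : 2 ≤ d)
    (A : EuclideanSpace ℝ (Fin d) →ₗ[ℝ] EuclideanSpace ℝ (Fin d))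
    (hsymm : ∀ u w, ⟪A u, w⟫ = ⟪u, A w⟫)
    (v₁ : EuclideanSpace ℝ (Fin d)) (l₁ l₂ : ℝ)
    (hv₁ : ‖v₁‖ = 1) (hAv₁ : A v₁ = l₁ • v₁)
    (hl₂ : ∀ w : EuclideanSpace ℝ (Fin d), ‖w‖ = 1 → ⟪w, v₁⟫ = 0 → ⟪w, A w⟫ ≤ l₂)
    (hgap : 0 < l₁ - l₂)
    (x : EuclideanSpace ℝ (Fin d)) (hx : ‖x‖ = 1) (hxv : 0 ≤ ⟪x, v₁⟫) :
    l₁ - ⟪x, A x⟫ ≥ (l₁ - l₂) / 4 * Real.arccos ⟪x, v₁⟫ ^ 2 := by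
  have hc : ⟪x, v₁⟫ ≤ 1 := by simpa [hx, hv₁] using real_inner_le_norm x v₁
  have hmul := mul_le_mul_of_nonneg_left (arccos_sq_div_four_le hxv hc) hgap.le
  linarith [eigengap_mul_one_sub_inner_sq_le hsymm hv₁ hAv₁ hl₂ hx]
end

section
/- Let x be a unit vector in ℝ^d with ⟨x, v₁⟩ ≥ a for some a > 0. Then the function f(x) = −xᵀAx is gradient dominated: ‖grad f(x)‖² ≥ δ·a²·(f(x) − f*), i.e. ‖2(xᵀAx)x − 2Ax‖² ≥ δ·a²·(λ₁ − xᵀAx). -/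
open RealInnerProductSpace

/-- A quadratic form bounded by `l` on the unit vectors satisfying a homogeneous linear equation is
bounded by `l * ‖w‖ ^ 2` on all solutions of that equation. -/
lemma inner_map_self_le_mul_norm_sq {E : Type*} [NormedAddCommGroup E] [InnerProductSpace ℝ E]
    (A : E →ₗ[ℝ] E) (v : E) (l : ℝ)
    (h : ∀ w : E, ‖w‖ = 1 → ⟪w, v⟫ = 0 → ⟪w, A w⟫ ≤ l) (w : E) (hw : ⟪w, v⟫ = 0) :
    ⟪w, A w⟫ ≤ l * ‖w‖ ^ 2 := by
  rcases eq_or_ne w 0 with rfl | hw0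
  · simp
  have hn : 0 < ‖w‖ := norm_pos_iff.mpr hw0
  have hu := h (‖w‖⁻¹ • w) (norm_smul_inv_norm (𝕜 := ℝ) hw0)
    (by rw [real_inner_smul_left, hw, mul_zero])
  rw [map_smul, real_inner_smul_left, real_inner_smul_right] at hu
  calc ⟪w, A w⟫ = (‖w‖⁻¹ * (‖w‖⁻¹ * ⟪w, A w⟫)) * ‖w‖ ^ 2 := by field_simp
    _ ≤ l * ‖w‖ ^ 2 := by gcongr

/-- gradient dominance. For a unit vector `x` with `⟨x,v₁⟩ ≥ a > 0`,
the function `f(x) = −xᵀAx` satisfies `‖grad f(x)‖² ≥ δ·a²·(f(x) − f*)`, i.e.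
`‖2(xᵀAx)x − 2Ax‖² ≥ δ·a²·(λ₁ − xᵀAx)` with `δ = λ₁ − λ₂ > 0`, `f* = −λ₁`. -/
theorem stmt_7 {d : ℕ} (hd : 2 ≤ d)
    (A : EuclideanSpace ℝ (Fin d) →ₗ[ℝ] EuclideanSpace ℝ (Fin d))
    (hsymm : ∀ u w, ⟪A u, w⟫ = ⟪u, A w⟫)
    (hpsd : ∀ u, 0 ≤ ⟪u, A u⟫)
    (v₁ : EuclideanSpace ℝ (Fin d)) (l₁ l₂ : ℝ)
    (hv₁ : ‖v₁‖ = 1) (hAv₁ : A v₁ = l₁ • v₁)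
    (hmax : ∀ u : EuclideanSpace ℝ (Fin d), ‖u‖ = 1 → ⟪u, A u⟫ ≤ l₁)
    (hl₂ : ∀ w : EuclideanSpace ℝ (Fin d), ‖w‖ = 1 → ⟪w, v₁⟫ = 0 → ⟪w, A w⟫ ≤ l₂)
    (hgap : 0 < l₁ - l₂)
    (a : ℝ) (ha : 0 < a)
    (x : EuclideanSpace ℝ (Fin d)) (hx : ‖x‖ = 1) (hxa : a ≤ ⟪x, v₁⟫) :
    ‖(2 * ⟪x, A x⟫) • x - (2 : ℝ) • A x‖ ^ 2 ≥
      (l₁ - l₂) * a ^ 2 * (l₁ - ⟪x, A x⟫) := by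
  set c := ⟪x, v₁⟫ with hc
  set r := ⟪x, A x⟫ with hr
  have hvx : ⟪v₁, x⟫ = c := real_inner_comm _ _
  have hxx : ⟪x, x⟫ = 1 := by rw [real_inner_self_eq_norm_sq, hx, one_pow]
  have hvv : ⟪v₁, v₁⟫ = 1 := by rw [real_inner_self_eq_norm_sq, hv₁, one_pow]
  have hvA : ⟪v₁, A x⟫ = l₁ * c := by rw [← hsymm, hAv₁, real_inner_smul_left, hvx]
  set w := x - c • v₁ with hw
  have hwv : ⟪w, v₁⟫ = 0 := by
    rw [hw, inner_sub_left, real_inner_smul_left, hvv, ← hc]; ring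
  have hs : ‖w‖ ^ 2 = 1 - c ^ 2 := by
    rw [← real_inner_self_eq_norm_sq, hw]
    simp only [inner_sub_left, inner_sub_right, real_inner_smul_left, real_inner_smul_right,
      hxx, hvv, hvx, ← hc]
    ring
  have hwA : ⟪w, A w⟫ = r - l₁ * c ^ 2 := by
    rw [hw]
    simp only [map_sub, map_smul, hAv₁, inner_sub_left, inner_sub_right, real_inner_smul_left,
      real_inner_smul_right, hvv, hvA, ← hc, ← hr]
    ring
  have hgrowth : (l₁ - l₂) * ‖w‖ ^ 2 ≤ l₁ - r := by
    have h := inner_map_self_le_mul_norm_sq A v₁ l₂ hl₂ w hwv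
    rw [hwA, hs] at h
    rw [hs]
    linarith
  have hq : 0 ≤ l₁ - r := sub_nonneg.mpr (hmax x hx)
  have hwB : ⟪w, l₁ • x - A x⟫ = l₁ - r := by
    rw [hw]
    simp only [inner_sub_left, inner_sub_right, real_inner_smul_left, real_inner_smul_right,
      hxx, hvx, hvA, ← hr]
    ring
  have hcs : (l₁ - r) ^ 2 ≤ ‖w‖ ^ 2 * ‖l₁ • x - A x‖ ^ 2 := by
    rw [← hwB, ← mul_pow]
    exact sq_le_sq' (neg_le_of_abs_le (abs_real_inner_le_norm _ _)) (real_inner_le_norm _ _)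
  have hgrad : ‖(2 * r) • x - (2 : ℝ) • A x‖ ^ 2
      = 4 * (‖l₁ • x - A x‖ ^ 2 - (l₁ - r) ^ 2) := by
    simp only [norm_sub_sq_real, norm_smul, mul_pow, Real.norm_eq_abs, sq_abs,
      real_inner_smul_left, real_inner_smul_right, hx, ← hr]
    ring
  have hac : a ^ 2 ≤ c ^ 2 := by gcongr
  rw [hgrad, ge_iff_le]
  rcases (sq_nonneg ‖w‖).eq_or_lt' with h0 | hpos
  · have hq0 : l₁ - r = 0 := by
      rw [h0, zero_mul] at hcs
      exact pow_eq_zero_iff two_ne_zero |>.mp (le_antisymm hcs (sq_nonneg _))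
    rw [hq0]
    nlinarith [sq_nonneg ‖l₁ • x - A x‖]
  · have hbound : (l₁ - l₂) * c ^ 2 * (l₁ - r) ≤ ‖l₁ • x - A x‖ ^ 2 - (l₁ - r) ^ 2 := by
      refine le_of_mul_le_mul_left ?_ hpos
      have hmul := mul_le_mul_of_nonneg_right hgrowth (mul_nonneg hq (sq_nonneg c))
      have hcw : c ^ 2 = 1 - ‖w‖ ^ 2 := by linarith
      calc ‖w‖ ^ 2 * ((l₁ - l₂) * c ^ 2 * (l₁ - r))
          = (l₁ - l₂) * ‖w‖ ^ 2 * ((l₁ - r) * c ^ 2) := by ring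
        _ ≤ (l₁ - r) * ((l₁ - r) * c ^ 2) := hmul
        _ = (l₁ - r) ^ 2 - ‖w‖ ^ 2 * (l₁ - r) ^ 2 := by rw [hcw]; ring
        _ ≤ ‖w‖ ^ 2 * (‖l₁ • x - A x‖ ^ 2 - (l₁ - r) ^ 2) := by linarith
    have hle : (l₁ - l₂) * a ^ 2 * (l₁ - r) ≤ (l₁ - l₂) * c ^ 2 * (l₁ - r) := by gcongr
    have hnn : 0 ≤ (l₁ - l₂) * c ^ 2 * (l₁ - r) := by positivity
    linarith
end

section
/- Let f : ℝ^d → ℝ be differentiable, x* a unit vector, and x a unit vector with x ≠ ±x*. Let G(x) = ∇f(x) − ⟨∇f(x), x⟩x. If f(x) − f(x*) ≤ (1/a)·⟨G(x), −log_x(x*)⟩ − (μ/2)·dist²(x, x*) for some a, μ > 0, then f(x) − f(x*) ≤ (1/(2a²μ))·‖G(x)‖². -/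
open RealInnerProductSpace

/-- The geodesic distance on the unit sphere: `dist(p,q) = arccos⟨p,q⟩`. -/
noncomputable def sphereDist {d : ℕ} (p q : EuclideanSpace ℝ (Fin d)) : ℝ :=
  Real.arccos ⟪p, q⟫

/-- The norm of the spherical logarithm is bounded by the geodesic distance. -/
theorem norm_sphereLog_le_sphereDist {d : ℕ} (x y : EuclideanSpace ℝ (Fin d)) :
    ‖sphereLog x y‖ ≤ sphereDist x y := by
  unfold sphereLog sphereDist
  rw [norm_smul, norm_smul, norm_inv, norm_norm, Real.norm_of_nonneg (Real.arccos_nonneg _),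
    real_inner_comm]
  exact mul_le_of_le_one_right (Real.arccos_nonneg _) inv_mul_le_one

/-- Young's inequality in the form obtained by maximizing a concave quadratic in `t`. -/
theorem one_div_mul_mul_sub_le (g t : ℝ) {a μ : ℝ} (ha : 0 < a) (hμ : 0 < μ) :
    1 / a * (g * t) - μ / 2 * t ^ 2 ≤ 1 / (2 * a ^ 2 * μ) * g ^ 2 := by
  have h : 1 / (2 * a ^ 2 * μ) * g ^ 2 - (1 / a * (g * t) - μ / 2 * t ^ 2) =
      (g / a - μ * t) ^ 2 / (2 * μ) := by
    field_simp
    ring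
  have h' : 0 ≤ (g / a - μ * t) ^ 2 / (2 * μ) := by positivity
  linarith

/-- if a differentiable `f : ℝ^d → ℝ` satisfies, at a unit vector
`x ≠ ±x*` (with `x*` a unit vector, `G(x) = ∇f(x) − ⟨∇f(x),x⟩x`), the inequality
`f(x) − f(x*) ≤ (1/a)·⟨G(x), −log_x(x*)⟩ − (μ/2)·dist²(x,x*)` for some `a, μ > 0`,
then `f(x) − f(x*) ≤ (1/(2a²μ))·‖G(x)‖²`. -/
theorem stmt_8 {d : ℕ} (hd : 2 ≤ d)
    (f : EuclideanSpace ℝ (Fin d) → ℝ) (hf : Differentiable ℝ f)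
    (xs : EuclideanSpace ℝ (Fin d)) (hxs : ‖xs‖ = 1)
    (x : EuclideanSpace ℝ (Fin d)) (hx : ‖x‖ = 1)
    (hne : x ≠ xs) (hne' : x ≠ -xs)
    (a μ : ℝ) (ha : 0 < a) (hμ : 0 < μ)
    (hSWC : f x - f xs ≤
      (1 / a) * ⟪gradient f x - ⟪gradient f x, x⟫ • x, -sphereLog x xs⟫
        - μ / 2 * sphereDist x xs ^ 2) :
    f x - f xs ≤
      1 / (2 * a ^ 2 * μ) * ‖gradient f x - ⟪gradient f x, x⟫ • x‖ ^ 2 := by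
  set G := gradient f x - ⟪gradient f x, x⟫ • x
  have hinner : ⟪G, -sphereLog x xs⟫ ≤ ‖G‖ * sphereDist x xs :=
    (real_inner_le_norm _ _).trans <| by
      rw [norm_neg]
      gcongr
      exact norm_sphereLog_le_sphereDist x xs
  have hscaled : 1 / a * ⟪G, -sphereLog x xs⟫ ≤ 1 / a * (‖G‖ * sphereDist x xs) := by
    gcongr
  linarith [one_div_mul_mul_sub_le ‖G‖ (sphereDist x xs) ha hμ]
end

section
/- The function f(x) = −xᵀAx is geodesically 2λ₁-smooth on the sphere: let p be a unit vector, v ∈ ℝ^d a nonzero vector with ⟨p, v⟩ = 0 and ‖v‖ ≤ π, and q = exp_p(v) = cos(‖v‖)p + sin(‖v‖)v/‖v‖. Let Γ denote parallel transport from the tangent space at p to the tangent space at q along the geodesic t ↦ exp_p(tv), given by Γu = u + (cos(‖v‖) − 1)·(⟨v,u⟩/‖v‖²)·v − sin(‖v‖)·(⟨v,u⟩/‖v‖)·p. Then ‖grad f(q) − Γ(grad f(p))‖ ≤ 2λ₁·‖v‖ = 2λ₁·dist(p, q). -/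
open RealInnerProductSpace

section
variable {E : Type*} [NormedAddCommGroup E] [InnerProductSpace ℝ E]

lemma norm_smul_add_sq_of_orthogonal {w n : E} (hw : ‖w‖ = 1) (hn : ⟪w, n⟫ = 0) (x : ℝ) :
    ‖x • w + n‖ ^ 2 = x ^ 2 + ‖n‖ ^ 2 := by
  rw [norm_add_sq_real, inner_smul_left, hn, norm_smul, hw]
  simp

lemma inner_map_self_le {A : E →ₗ[ℝ] E} {l : ℝ}
    (hmax : ∀ u : E, ‖u‖ = 1 → ⟪u, A u⟫ ≤ l) (u : E) : ⟪u, A u⟫ ≤ l * ‖u‖ ^ 2 := by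
  rcases eq_or_ne u 0 with rfl | hu
  · simp
  · have h := hmax (‖u‖⁻¹ • u) (norm_smul_inv_norm (𝕜 := ℝ) hu)
    have hn : 0 < ‖u‖ := norm_pos_iff.mpr hu
    rw [map_smul, inner_smul_left, inner_smul_right, RCLike.conj_to_real] at h
    calc ⟪u, A u⟫ = ‖u‖⁻¹ * (‖u‖⁻¹ * ⟪u, A u⟫) * ‖u‖ ^ 2 := by field_simp
      _ ≤ l * ‖u‖ ^ 2 := by gcongr

/-- If `0 ≤ A ≤ l` then `A² ≤ l A`. -/
lemma norm_map_sq_le {A : E →ₗ[ℝ] E} (hsymm : ∀ u w, ⟪A u, w⟫ = ⟪u, A w⟫)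
    (hpsd : ∀ u, 0 ≤ ⟪u, A u⟫) {l : ℝ} (hl : 0 ≤ l)
    (hmax : ∀ u : E, ⟪u, A u⟫ ≤ l * ‖u‖ ^ 2) (u : E) :
    ‖A u‖ ^ 2 ≤ l * ⟪u, A u⟫ := by
  have key : ∀ c : ℝ, 0 < c → l ≤ c → ‖A u‖ ^ 2 ≤ c * ⟪u, A u⟫ := by
    intro c hc hlc
    have h1 := hpsd (c • u - A u)
    have h2 : ⟪A u, A (A u)⟫ ≤ c * ‖A u‖ ^ 2 :=
      (hmax (A u)).trans (by gcongr)
    simp only [map_sub, map_smul, inner_sub_left, inner_sub_right, inner_smul_left,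
      inner_smul_right, RCLike.conj_to_real, ← hsymm u (A u), real_inner_self_eq_norm_sq] at h1
    refine le_of_mul_le_mul_left ?_ hc
    linarith
  rcases hl.eq_or_lt with rfl | hl
  · have h1 := key 1 one_pos zero_le_one
    have h2 := hmax u
    linarith
  · exact key l hl le_rfl

/-- The Hessian of `x ↦ -⟪x, A x⟫ / 2` on the sphere has operator norm at most `l`; here it is
applied to `r` at the point `q`. -/
lemma sphere_hessian_sq_le {A : E →ₗ[ℝ] E} (hsymm : ∀ u w, ⟪A u, w⟫ = ⟪u, A w⟫)
    (hpsd : ∀ u, 0 ≤ ⟪u, A u⟫) {l : ℝ} (hmax : ∀ u : E, ‖u‖ = 1 → ⟪u, A u⟫ ≤ l)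
    {q r : E} (hq : ‖q‖ = 1) (hr : ‖r‖ = 1) :
    (⟪r, A r⟫ - ⟪q, A q⟫) ^ 2 + (‖A r‖ ^ 2 - ⟪q, A r⟫ ^ 2 - ⟪r, A r⟫ ^ 2) ≤ l ^ 2 := by
  have hα := hpsd r
  have hβ := hpsd q
  have hα' := hmax r hr
  have hβ' := hmax q hq
  have h := norm_map_sq_le hsymm hpsd (hα.trans hα') (inner_map_self_le hmax) r
  nlinarith [sq_nonneg ⟪q, A r⟫, mul_nonneg hα hβ, mul_nonneg (sub_nonneg.2 hα') hβ,
    mul_nonneg (sub_nonneg.2 hβ') (sub_nonneg.2 hα'), mul_nonneg (sub_nonneg.2 hβ') hα]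

/-- The component of `x` orthogonal to the orthonormal vectors `p` and `w`. -/
noncomputable def perpPart (p w x : E) : E := x - ⟪p, x⟫ • p - ⟪w, x⟫ • w

lemma inner_perpPart {p w : E} (hp : ‖p‖ = 1) (hw : ‖w‖ = 1) (hpw : ⟪p, w⟫ = 0) (x : E) :
    ⟪p, perpPart p w x⟫ = 0 ∧ ⟪w, perpPart p w x⟫ = 0 := by
  have hwp : ⟪w, p⟫ = 0 := by rw [real_inner_comm]; exact hpw
  simp [perpPart, inner_sub_right, inner_smul_right, hp, hw, hpw, hwp]

lemma norm_perpPart_sq {p w : E} (hp : ‖p‖ = 1) (hw : ‖w‖ = 1) (hpw : ⟪p, w⟫ = 0) (x : E) :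
    ‖perpPart p w x‖ ^ 2 = ‖x‖ ^ 2 - ⟪p, x⟫ ^ 2 - ⟪w, x⟫ ^ 2 := by
  obtain ⟨h1, h2⟩ := inner_perpPart hp hw hpw x
  rw [← real_inner_self_eq_norm_sq]
  nth_rewrite 1 [perpPart]
  rw [inner_sub_left, inner_sub_left, inner_smul_left, inner_smul_left, h1, h2]
  simp only [perpPart, inner_sub_right, inner_smul_right, real_inner_self_eq_norm_sq]
  rw [real_inner_comm p x, real_inner_comm w x]
  ring

lemma norm_cos_smul_add_sin_smul {p w : E} (hp : ‖p‖ = 1) (hw : ‖w‖ = 1) (hpw : ⟪p, w⟫ = 0)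
    {c s : ℝ} (hcs : c ^ 2 + s ^ 2 = 1) : ‖c • p + s • w‖ = 1 := by
  have h : ‖c • p + s • w‖ ^ 2 = 1 := by
    rw [norm_smul_add_sq_of_orthogonal hp (by simp [inner_smul_right, hpw]), norm_smul, hw,
      mul_one, Real.norm_eq_abs, sq_abs, hcs]
  exact (pow_eq_one_iff_of_nonneg (norm_nonneg _) two_ne_zero).1 h

/-- Half the negative gradient of `x ↦ -⟪x, A x⟫` along the geodesic `t ↦ cos t • p + sin t • w`,
transported back to `p`. -/
noncomputable def transportedGrad (A : E →ₗ[ℝ] E) (p w : E) (t : ℝ) : E :=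
  ((⟪w, A w⟫ - ⟪p, A p⟫) * (Real.sin t * Real.cos t)
      + ⟪p, A w⟫ * (Real.cos t ^ 2 - Real.sin t ^ 2)) • w
    + (Real.cos t • perpPart p w (A p) + Real.sin t • perpPart p w (A w))

lemma norm_transportedGrad_sub_le {A : E →ₗ[ℝ] E} (hsymm : ∀ u w, ⟪A u, w⟫ = ⟪u, A w⟫)
    (hpsd : ∀ u, 0 ≤ ⟪u, A u⟫) {l : ℝ} (hmax : ∀ u : E, ‖u‖ = 1 → ⟪u, A u⟫ ≤ l)
    {p w : E} (hp : ‖p‖ = 1) (hw : ‖w‖ = 1) (hpw : ⟪p, w⟫ = 0) {θ : ℝ} (hθ : 0 ≤ θ) :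
    ‖transportedGrad A p w θ - transportedGrad A p w 0‖ ≤ l * θ := by
  have hwp : ⟪w, A p⟫ = ⟪p, A w⟫ := by rw [← hsymm w p, real_inner_comm]
  set F' : ℝ → E := fun t =>
    ((⟪w, A w⟫ - ⟪p, A p⟫) * (Real.cos t ^ 2 - Real.sin t ^ 2)
      - 4 * ⟪p, A w⟫ * (Real.sin t * Real.cos t)) • w
    + ((-Real.sin t) • perpPart p w (A p) + Real.cos t • perpPart p w (A w)) with hF'
  have hderiv : ∀ t, HasDerivAt (transportedGrad A p w) (F' t) t := by
    intro t
    have hs := Real.hasDerivAt_sin t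
    have hc := Real.hasDerivAt_cos t
    have h := ((((hs.mul hc).const_mul (⟪w, A w⟫ - ⟪p, A p⟫)).add
      (((hc.pow 2).sub (hs.pow 2)).const_mul ⟪p, A w⟫)).smul_const w).add
      ((hc.smul_const (perpPart p w (A p))).add (hs.smul_const (perpPart p w (A w))))
    refine h.congr_deriv ?_
    simp only [hF']
    congr 2
    push_cast
    ring
  have hbound : ∀ t, ‖F' t‖ ≤ l := by
    intro t
    have hcs := Real.cos_sq_add_sin_sq t
    set c := Real.cos t with hc
    set s := Real.sin t with hs
    have hlin : (-s) • perpPart p w (A p) + c • perpPart p w (A w)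
        = perpPart p w (A ((-s) • p + c • w)) := by
      simp only [perpPart, map_add, map_smul, inner_add_right, inner_smul_right]
      module
    have hq := norm_cos_smul_add_sin_smul hp hw hpw hcs
    have hr := norm_cos_smul_add_sin_smul hp hw hpw (c := -s) (s := c) (by linarith)
    have H := sphere_hessian_sq_le hsymm hpsd hmax hq hr
    have hl : 0 ≤ l := (hpsd p).trans (hmax p hp)
    refine le_of_sq_le_sq ?_ hl
    simp only [hF']
    rw [← hc, ← hs, hlin,
      norm_smul_add_sq_of_orthogonal hw (inner_perpPart hp hw hpw _).2,
      norm_perpPart_sq hp hw hpw]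
    refine le_trans (le_of_eq ?_) H
    generalize ‖A ((-s) • p + c • w)‖ ^ 2 = N
    simp only [map_add, map_smul, inner_add_right, inner_smul_right, inner_add_left,
      inner_smul_left, RCLike.conj_to_real, hwp]
    generalize ⟪w, A w⟫ = e
    generalize ⟪p, A p⟫ = a
    generalize ⟪p, A w⟫ = b
    linear_combination ((-s * a + c * b) ^ 2 + (-s * b + c * e) ^ 2) * hcs
  have h := (convex_Icc (0 : ℝ) θ).norm_image_sub_le_of_norm_hasDerivWithin_le
    (f := transportedGrad A p w) (f' := F') (C := l)
    (fun t _ => (hderiv t).hasDerivWithinAt) (fun t _ => hbound t)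
    (Set.left_mem_Icc.2 hθ) (Set.right_mem_Icc.2 hθ)
  simpa [Real.norm_eq_abs, abs_of_nonneg hθ] using h

end

/-- geodesic `2λ₁`-smoothness of `f(x) = −xᵀAx` on the sphere.
For a unit vector `p`, a nonzero tangent vector `v` (`⟨p,v⟩ = 0`) with `‖v‖ ≤ π`,
let `q = exp_p(v) = cos(‖v‖)p + sin(‖v‖)v/‖v‖`, and let `Γ` be the parallel
transport along the geodesic `t ↦ exp_p(tv)`, given for a tangent vector `u` by
`Γu = u + (cos‖v‖ − 1)(⟨v,u⟩/‖v‖²)v − sin(‖v‖)(⟨v,u⟩/‖v‖)p`. Then, with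
`grad f(x) = 2(xᵀAx)x − 2Ax`, we have `‖grad f(q) − Γ(grad f(p))‖ ≤ 2λ₁‖v‖`. -/
theorem stmt_9 {d : ℕ} (hd : 2 ≤ d)
    (A : EuclideanSpace ℝ (Fin d) →ₗ[ℝ] EuclideanSpace ℝ (Fin d))
    (hsymm : ∀ u w, ⟪A u, w⟫ = ⟪u, A w⟫)
    (hpsd : ∀ u, 0 ≤ ⟪u, A u⟫)
    (l₁ : ℝ)
    (hmax : ∀ u : EuclideanSpace ℝ (Fin d), ‖u‖ = 1 → ⟪u, A u⟫ ≤ l₁)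
    (p v : EuclideanSpace ℝ (Fin d)) (hp : ‖p‖ = 1) (hv : v ≠ 0)
    (hpv : ⟪p, v⟫ = 0) (hvπ : ‖v‖ ≤ Real.pi)
    (q : EuclideanSpace ℝ (Fin d))
    (hq : q = Real.cos ‖v‖ • p + (Real.sin ‖v‖ / ‖v‖) • v)
    (g : EuclideanSpace ℝ (Fin d))
    (hg : g = (2 * ⟪p, A p⟫) • p - (2 : ℝ) • A p)
    (Γg : EuclideanSpace ℝ (Fin d))
    (hΓg : Γg = g + ((Real.cos ‖v‖ - 1) * (⟪v, g⟫ / ‖v‖ ^ 2)) • v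
        - (Real.sin ‖v‖ * (⟪v, g⟫ / ‖v‖)) • p) :
    ‖((2 * ⟪q, A q⟫) • q - (2 : ℝ) • A q) - Γg‖ ≤ 2 * l₁ * ‖v‖ := by
  have hθ : 0 < ‖v‖ := norm_pos_iff.2 hv
  obtain ⟨θ, hθv⟩ : ∃ θ, ‖v‖ = θ := ⟨_, rfl⟩
  rw [hθv] at hθ hq hΓg ⊢
  obtain ⟨w, rfl⟩ : ∃ w, v = θ • w := ⟨θ⁻¹ • v, by rw [smul_inv_smul₀ hθ.ne']⟩
  have hw : ‖w‖ = 1 := by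
    rw [norm_smul, Real.norm_of_nonneg hθ.le] at hθv
    exact mul_left_cancel₀ hθ.ne' (by linarith)
  have hpw : ⟪p, w⟫ = 0 := by
    rw [inner_smul_right] at hpv
    exact (mul_eq_zero.1 hpv).resolve_left hθ.ne'
  have hwp0 : ⟪w, p⟫ = 0 := by rw [real_inner_comm]; exact hpw
  have hwp : ⟪w, A p⟫ = ⟪p, A w⟫ := by rw [← hsymm w p, real_inner_comm]
  have main := norm_transportedGrad_sub_le hsymm hpsd hmax hp hw hpw hθ.le
  have hcs := Real.cos_sq_add_sin_sq θ
  have hq' : q = Real.cos θ • p + Real.sin θ • w := by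
    rw [hq, smul_smul, div_mul_cancel₀ _ hθ.ne']
  have hvg : ⟪θ • w, g⟫ = -2 * θ * ⟪p, A w⟫ := by
    simp only [hg, inner_sub_right, inner_smul_left, inner_smul_right, hwp0, hwp,
      RCLike.conj_to_real]
    ring
  have hΓ : Γg = g + ((Real.cos θ - 1) * (-2 * ⟪p, A w⟫)) • w
      - (Real.sin θ * (-2 * ⟪p, A w⟫)) • p := by
    rw [hΓg, hvg, smul_smul]
    congr 3
    · field_simp
    · field_simp
  set c := Real.cos θ with hc
  set s := Real.sin θ with hs
  set x := (⟪w, A w⟫ - ⟪p, A p⟫) * (s * c) + ⟪p, A w⟫ * (c ^ 2 - s ^ 2) - ⟪p, A w⟫ with hx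
  set n := perpPart p w (A (c • p + s • w - p)) with hn
  have hF : transportedGrad A p w θ - transportedGrad A p w 0 = x • w + n := by
    simp only [transportedGrad, hn, hx, perpPart, map_sub, map_add, map_smul, inner_sub_right,
      inner_add_right, inner_smul_right, Real.sin_zero, Real.cos_zero, ← hc, ← hs]
    module
  have hG : (2 * ⟪q, A q⟫) • q - (2 : ℝ) • A q - Γg
      = (-2 : ℝ) • (x • ((-s) • p + c • w) + n) := by
    rw [hΓ, hg, hq']
    simp only [hn, hx, perpPart, map_sub, map_add, map_smul, inner_sub_right,
      inner_add_right, inner_smul_right, inner_add_left, inner_smul_left,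
      RCLike.conj_to_real, hwp]
    generalize ⟪w, A w⟫ = e
    generalize ⟪p, A p⟫ = a
    generalize ⟪p, A w⟫ = b
    match_scalars
    · linear_combination 2 * (c * a + s * b) * hcs
    · linear_combination 2 * (s * e + c * b) * hcs
    · ring
    · ring
  have hr := norm_cos_smul_add_sin_smul hp hw hpw (c := -s) (s := c) (by linarith)
  obtain ⟨h1, h2⟩ := inner_perpPart hp hw hpw (A (c • p + s • w - p))
  have hnorm : ‖x • ((-s) • p + c • w) + n‖ = ‖x • w + n‖ := by
    rw [← sq_eq_sq₀ (norm_nonneg _) (norm_nonneg _),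
      norm_smul_add_sq_of_orthogonal hw h2,
      norm_smul_add_sq_of_orthogonal hr
        (by rw [inner_add_left, inner_smul_left, inner_smul_left, h1, h2]; simp)]
  rw [hG, norm_smul, hnorm, ← hF]
  norm_num
  linarith
end

section
/- Let x be a unit vector in ℝ^d with ⟨x, v₁⟩ ≥ a for some a > 0, let γ ≥ 2λ₁ and 0 < η ≤ a/γ, and let x' = exp_x(−η·grad f(x)) be one iterate of Riemannian gradient descent on f(x) = −xᵀAx. Then dist²(x', v₁) ≤ (1 − aμη)·dist²(x, v₁), where μ = δ/2. -/
open RealInnerProductSpace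
open scoped Classical

/-- The exponential map of the unit sphere at `x`:
`exp_x(u) = cos(‖u‖)x + sin(‖u‖)u/‖u‖` for `u ≠ 0`, and `exp_x(0) = x`. -/
noncomputable def sphereExp {d : ℕ} (x u : EuclideanSpace ℝ (Fin d)) :
    EuclideanSpace ℝ (Fin d) :=
  if u = 0 then x else Real.cos ‖u‖ • x + (Real.sin ‖u‖ / ‖u‖) • u
/-- On `(0, π]` the function `sin y / y` is antitone. -/
lemma sin_div_antitone {y z : ℝ} (hy : 0 < y) (hyz : y ≤ z) (hz : z ≤ Real.pi) :
    Real.sin z / z ≤ Real.sin y / y := by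
  have hz0 : 0 < z := hy.trans_le hyz
  have h := strictConcaveOn_sin_Icc.concaveOn.2 (x := 0) (y := z)
    ⟨le_rfl, Real.pi_pos.le⟩ ⟨hz0.le, hz⟩
    (sub_nonneg.2 ((div_le_one hz0).2 hyz)) (div_nonneg hy.le hz0.le) (by ring)
  simp only [smul_eq_mul, Real.sin_zero, mul_zero, zero_add, div_mul_cancel₀ _ hz0.ne'] at h
  rw [le_div_iff₀ hy]
  calc Real.sin z / z * y = y / z * Real.sin z := by ring
    _ ≤ Real.sin y := h

lemma convexOn_cos_sqrt :
    ConvexOn ℝ (Set.Icc 0 (Real.pi ^ 2)) fun u => Real.cos √u := by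
  have hderiv : ∀ u ∈ interior (Set.Icc 0 (Real.pi ^ 2)),
      HasDerivAt (fun u => Real.cos √u) (-(Real.sin √u / √u) / 2) u := by
    intro u hu
    rw [interior_Icc] at hu
    have h := (Real.hasDerivAt_cos √u).comp u (Real.hasDerivAt_sqrt hu.1.ne')
    refine h.congr_deriv ?_
    have : √u ≠ 0 := (Real.sqrt_pos.2 hu.1).ne'
    field_simp
  refine MonotoneOn.convexOn_of_deriv (convex_Icc _ _) (by fun_prop)
    (fun u hu => (hderiv u hu).differentiableAt.differentiableWithinAt) ?_
  intro u hu v hv huv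
  rw [(hderiv u hu).deriv, (hderiv v hv).deriv]
  rw [interior_Icc] at hu hv
  have := sin_div_antitone (Real.sqrt_pos.2 hu.1) (Real.sqrt_le_sqrt huv)
    (Real.sqrt_le_iff.2 ⟨Real.pi_pos.le, hv.2.le⟩)
  linarith

/-- Comparison of the spherical law of cosines with the Euclidean one: with two given sides and
a given angle between them, the third side is at most as long on the sphere as in the plane. -/
lemma arccos_sq_le_of_sides {p t k : ℝ} (hp : 0 ≤ p) (ht : 0 ≤ t) (hpt : p + t ≤ Real.pi)
    (hk : |k| ≤ 1) :
    Real.arccos (Real.cos p * Real.cos t + Real.sin p * Real.sin t * k) ^ 2 ≤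
      p ^ 2 + t ^ 2 - 2 * p * t * k := by
  obtain ⟨hk1, hk2⟩ := abs_le.1 hk
  have hm : (p - t) ^ 2 ∈ Set.Icc 0 (Real.pi ^ 2) :=
    ⟨sq_nonneg _, by nlinarith [mul_nonneg hp ht]⟩
  have hM : (p + t) ^ 2 ∈ Set.Icc 0 (Real.pi ^ 2) :=
    ⟨sq_nonneg _, by nlinarith⟩
  have ha : 0 ≤ (1 + k) / 2 := by linarith
  have hb : 0 ≤ (1 - k) / 2 := by linarith
  have h := convexOn_cos_sqrt.2 hm hM ha hb (by ring)
  have hmem := (convex_Icc 0 (Real.pi ^ 2)) hm hM ha hb (by ring)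
  have e : ((1 + k) / 2) • (p - t) ^ 2 + ((1 - k) / 2) • (p + t) ^ 2 =
      p ^ 2 + t ^ 2 - 2 * p * t * k := by
    simp only [smul_eq_mul]; ring
  rw [e] at h hmem
  have e2 : ((1 + k) / 2) • Real.cos √((p - t) ^ 2) + ((1 - k) / 2) • Real.cos √((p + t) ^ 2) =
      Real.cos p * Real.cos t + Real.sin p * Real.sin t * k := by
    rw [Real.sqrt_sq_eq_abs, Real.sqrt_sq_eq_abs, Real.cos_abs, Real.cos_abs, Real.cos_add,
      Real.cos_sub]
    simp only [smul_eq_mul]; ring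
  rw [e2] at h
  have hle := Real.arccos_le_arccos h
  rw [Real.arccos_cos (Real.sqrt_nonneg _)
    (Real.sqrt_le_iff.2 ⟨Real.pi_pos.le, hmem.2⟩)] at hle
  calc _ ≤ √(p ^ 2 + t ^ 2 - 2 * p * t * k) ^ 2 :=
        pow_le_pow_left₀ (Real.arccos_nonneg _) hle 2
    _ = _ := Real.sq_sqrt hmem.1

section QuadraticForm

variable {E : Type*} [NormedAddCommGroup E] [InnerProductSpace ℝ E] {A : E →ₗ[ℝ] E}

lemma inner_map_le_mul_norm_sq {P : E → Prop} {l : ℝ} (hP : ∀ (c : ℝ) u, P u → P (c • u))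
    (h : ∀ u, ‖u‖ = 1 → P u → ⟪u, A u⟫ ≤ l) {u : E} (hu : P u) :
    ⟪u, A u⟫ ≤ l * ‖u‖ ^ 2 := by
  rcases eq_or_ne u 0 with rfl | h0
  · simp
  have hn : 0 < ‖u‖ := norm_pos_iff.2 h0
  have := h (‖u‖⁻¹ • u) (by simp [norm_smul, hn.ne']) (hP _ _ hu)
  rw [map_smul, inner_smul_left, inner_smul_right] at this
  simp only [conj_trivial] at this
  rw [← mul_assoc, ← mul_inv, inv_mul_le_iff₀ (by positivity)] at this
  linarith

lemma norm_map_sq_le_mul_inner (hsymm : ∀ u w, ⟪A u, w⟫ = ⟪u, A w⟫)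
    (hpsd : ∀ u, 0 ≤ ⟪u, A u⟫) {l : ℝ} (hl : 0 < l) (hmax : ∀ u, ⟪u, A u⟫ ≤ l * ‖u‖ ^ 2)
    (x : E) : ‖A x‖ ^ 2 ≤ l * ⟪x, A x⟫ := by
  have h := hpsd (l • x - A x)
  have hm := hmax (A x)
  simp only [map_sub, map_smul, inner_sub_left, inner_sub_right, inner_smul_left,
    inner_smul_right, conj_trivial] at h
  rw [← hsymm x (A x), real_inner_self_eq_norm_sq] at h
  nlinarith

lemma gap_mul_le_sub_inner_map (hsymm : ∀ u w, ⟪A u, w⟫ = ⟪u, A w⟫) {v x : E} {l₁ l₂ : ℝ}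
    (hv : ‖v‖ = 1) (hx : ‖x‖ = 1) (hAv : A v = l₁ • v)
    (hl₂ : ∀ w, ‖w‖ = 1 → ⟪w, v⟫ = 0 → ⟪w, A w⟫ ≤ l₂) :
    (l₁ - l₂) * (1 - ⟪x, v⟫ ^ 2) ≤ l₁ - ⟪x, A x⟫ := by
  have hxx : ⟪x, x⟫ = 1 := by rw [real_inner_self_eq_norm_sq, hx, one_pow]
  have hvv : ⟪v, v⟫ = 1 := by rw [real_inner_self_eq_norm_sq, hv, one_pow]
  have hvx : ⟪v, x⟫ = ⟪x, v⟫ := real_inner_comm _ _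
  have hvAx : ⟪v, A x⟫ = l₁ * ⟪x, v⟫ := by rw [← hsymm, hAv, inner_smul_left, hvx]; rfl
  have hzn : ‖x - ⟪x, v⟫ • v‖ ^ 2 = 1 - ⟪x, v⟫ ^ 2 := by
    rw [← real_inner_self_eq_norm_sq]
    simp only [inner_sub_left, inner_sub_right, inner_smul_left, inner_smul_right,
      conj_trivial, hxx, hvv, hvx]
    ring
  have hzA : ⟪x - ⟪x, v⟫ • v, A (x - ⟪x, v⟫ • v)⟫ = ⟪x, A x⟫ - l₁ * ⟪x, v⟫ ^ 2 := by
    simp only [map_sub, map_smul, hAv, inner_sub_left, inner_sub_right, inner_smul_left,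
      inner_smul_right, conj_trivial, hvv, hvAx]
    ring
  have hz : ⟪x - ⟪x, v⟫ • v, A (x - ⟪x, v⟫ • v)⟫ ≤ l₂ * ‖x - ⟪x, v⟫ • v‖ ^ 2 :=
    inner_map_le_mul_norm_sq (P := fun w => ⟪w, v⟫ = 0)
      (fun b u h => by rw [inner_smul_left, h, mul_zero]) hl₂
      (by rw [inner_sub_left, inner_smul_left, hvv]; simp)
  rw [hzA, hzn] at hz
  linarith

end QuadraticForm

/-- One step of length `η * G` from a point at spherical distance `arccos c` of the target, in a
direction whose inner product with the target is `2 * c * r / G`. -/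
lemma arccos_sq_descent {a c δ γ l r η G : ℝ} (ha : 0 < a) (hac : a ≤ c) (hc1 : c < 1)
    (hδ : 0 ≤ δ) (hlγ : 2 * l ≤ γ) (hη : 0 < η) (hηγ : η * γ ≤ a)
    (hr : δ * (1 - c ^ 2) ≤ r) (hr0 : 0 < r) (hG : 0 < G) (hGl : G ≤ l)
    (hGr : G ^ 2 ≤ 4 * l * r) (hcs : 2 * c * r ≤ G * √(1 - c ^ 2)) :
    Real.arccos (c * Real.cos (η * G) + Real.sin (η * G) / G * (2 * c * r)) ^ 2 ≤
      (1 - a * (δ / 2) * η) * Real.arccos c ^ 2 := by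
  have hc0 : 0 < c := ha.trans_le hac
  rw [← Real.sin_arccos] at hcs
  have hcos : Real.cos (Real.arccos c) = c := Real.cos_arccos (by linarith) hc1.le
  have hθ0 : 0 < Real.arccos c := Real.arccos_pos.2 hc1
  have hθ1 : Real.arccos c < Real.pi / 2 := Real.arccos_lt_pi_div_two.2 hc0
  generalize Real.arccos c = θ at *
  have hs0 : 0 < Real.sin θ := Real.sin_pos_of_pos_of_lt_pi hθ0 (by linarith [Real.pi_pos])
  have hsθ : Real.sin θ ≤ θ := Real.sin_le hθ0.le
  have hθs : θ ≤ 2 * Real.sin θ := by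
    have h := Real.mul_le_sin hθ0.le hθ1.le
    rw [div_mul_eq_mul_div, div_le_iff₀ Real.pi_pos] at h
    nlinarith [Real.pi_le_four]
  have hsc : 1 - c ^ 2 = Real.sin θ ^ 2 := by rw [Real.sin_sq, hcos]
  rw [hsc] at hr
  have ht0 : 0 < η * G := mul_pos hη hG
  have ht1 : η * G ≤ 1 / 2 := by
    have : η * G ≤ η * l := mul_le_mul_of_nonneg_left hGl hη.le
    have : η * (2 * l) ≤ η * γ := mul_le_mul_of_nonneg_left hlγ hη.le
    linarith
  obtain ⟨k, hk⟩ : ∃ k, k = 2 * c * r / (G * Real.sin θ) := ⟨_, rfl⟩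
  have hk0 : 0 ≤ k := by rw [hk]; positivity
  have hk1 : |k| ≤ 1 := by
    rwa [abs_of_nonneg hk0, hk, div_le_one (by positivity)]
  have hmain := arccos_sq_le_of_sides hθ0.le ht0.le (by linarith [Real.pi_gt_three]) hk1
  have e : c * Real.cos (η * G) + Real.sin (η * G) / G * (2 * c * r) =
      Real.cos θ * Real.cos (η * G) + Real.sin θ * Real.sin (η * G) * k := by
    rw [hcos, hk]
    field_simp
  rw [← e] at hmain
  have htks : Real.sin θ * (η * G * k) = 2 * η * c * r := by
    rw [hk]
    field_simp
  have hcross : 2 * η * a * r ≤ θ * (η * G * k) := by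
    calc 2 * η * a * r ≤ 2 * η * c * r := by gcongr
      _ = Real.sin θ * (η * G * k) := htks.symm
      _ ≤ θ * (η * G * k) := by gcongr
  have hstep : (η * G) ^ 2 ≤ 2 * η * a * r := by
    calc (η * G) ^ 2 = η ^ 2 * G ^ 2 := by ring
      _ ≤ η ^ 2 * (4 * l * r) := by gcongr
      _ = 2 * η * (η * (2 * l)) * r := by ring
      _ ≤ 2 * η * (η * γ) * r := by gcongr
      _ ≤ 2 * η * a * r := by gcongr
  have hgain : a * (δ / 2) * η * θ ^ 2 ≤ 2 * η * a * r := by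
    calc a * (δ / 2) * η * θ ^ 2 ≤ a * (δ / 2) * η * (2 * Real.sin θ) ^ 2 := by gcongr
      _ = 2 * η * a * (δ * Real.sin θ ^ 2) := by ring
      _ ≤ 2 * η * a * r := by gcongr
  linarith

/-- one iterate of Riemannian gradient descent on `f(x) = −xᵀAx`,
from a unit vector `x` with `⟨x,v₁⟩ ≥ a > 0`, with step-size `0 < η ≤ a/γ` where
`γ ≥ 2λ₁`, satisfies `dist²(x',v₁) ≤ (1 − aμη)·dist²(x,v₁)` with `μ = δ/2`,
`δ = λ₁ − λ₂ > 0`, where `x' = exp_x(−η·grad f(x))` and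
`grad f(x) = 2(xᵀAx)x − 2Ax`. -/
theorem stmt_10 {d : ℕ} (hd : 2 ≤ d)
    (A : EuclideanSpace ℝ (Fin d) →ₗ[ℝ] EuclideanSpace ℝ (Fin d))
    (hsymm : ∀ u w, ⟪A u, w⟫ = ⟪u, A w⟫)
    (hpsd : ∀ u, 0 ≤ ⟪u, A u⟫)
    (v₁ : EuclideanSpace ℝ (Fin d)) (l₁ l₂ : ℝ)
    (hv₁ : ‖v₁‖ = 1) (hAv₁ : A v₁ = l₁ • v₁)
    (hmax : ∀ u : EuclideanSpace ℝ (Fin d), ‖u‖ = 1 → ⟪u, A u⟫ ≤ l₁)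
    (hl₂ : ∀ w : EuclideanSpace ℝ (Fin d), ‖w‖ = 1 → ⟪w, v₁⟫ = 0 → ⟪w, A w⟫ ≤ l₂)
    (hgap : 0 < l₁ - l₂)
    (a : ℝ) (ha : 0 < a)
    (x : EuclideanSpace ℝ (Fin d)) (hx : ‖x‖ = 1) (hxa : a ≤ ⟪x, v₁⟫)
    (γ η : ℝ) (hγ : 2 * l₁ ≤ γ) (hη0 : 0 < η) (hη : η ≤ a / γ)
    (x' : EuclideanSpace ℝ (Fin d))
    (hx' : x' = sphereExp x (-η • ((2 * ⟪x, A x⟫) • x - (2 : ℝ) • A x))) :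
    sphereDist x' v₁ ^ 2 ≤
      (1 - a * ((l₁ - l₂) / 2) * η) * sphereDist x v₁ ^ 2 := by
  have hl₁ : 0 ≤ l₁ := by
    have h := hpsd v₁
    rwa [hAv₁, inner_smul_right, real_inner_self_eq_norm_sq, hv₁, one_pow, mul_one] at h
  have hγ0 : 0 < γ := by
    rcases (by linarith : 0 ≤ γ).eq_or_lt with h | h
    · rw [← h, div_zero] at hη
      linarith
    · exact h
  have hηγ : η * γ ≤ a := (le_div_iff₀ hγ0).1 hη
  set c := ⟪x, v₁⟫ with hc
  set q := ⟪x, A x⟫ with hq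
  have hc0 : 0 < c := ha.trans_le hxa
  have hc1 : c ≤ 1 := by simpa [hx, hv₁] using real_inner_le_norm x v₁
  have hxx : ⟪x, x⟫ = 1 := by rw [real_inner_self_eq_norm_sq, hx, one_pow]
  have hvv : ⟪v₁, v₁⟫ = 1 := by rw [real_inner_self_eq_norm_sq, hv₁, one_pow]
  have hvx : ⟪v₁, x⟫ = c := real_inner_comm _ _
  have hAxv : ⟪A x, v₁⟫ = l₁ * c := by rw [hsymm, hAv₁, inner_smul_right]
  have hAxx : ⟪A x, x⟫ = q := real_inner_comm _ _
  rcases hc1.eq_or_lt with hc1' | hc1'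
  · have hxv : x = v₁ := (inner_eq_one_iff_of_norm_eq_one (𝕜 := ℝ) hx hv₁).1 hc1'
    have hq1 : q = l₁ := by rw [hq, hxv, hAv₁, inner_smul_right, hvv, mul_one]
    have hu : -η • ((2 * q) • x - (2 : ℝ) • A x) = 0 := by
      rw [hq1, hxv, hAv₁, smul_smul, sub_self, smul_zero]
    have hx'x : x' = x := by rw [hx', hu, sphereExp, if_pos rfl]
    simp [hx'x, sphereDist, ← hc, hc1']
  have hsc : 0 < 1 - c ^ 2 := by nlinarith
  have hr : (l₁ - l₂) * (1 - c ^ 2) ≤ l₁ - q :=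
    gap_mul_le_sub_inner_map hsymm hv₁ hx hAv₁ hl₂
  have hr0 : 0 < l₁ - q := (mul_pos hgap hsc).trans_le hr
  have hl₁0 : 0 < l₁ := by linarith [hpsd x]
  set g := (2 : ℝ) • A x - (2 * q) • x with hg
  have hgv : ⟪g, v₁⟫ = 2 * c * (l₁ - q) := by
    simp only [hg, inner_sub_left, inner_smul_left, conj_trivial, hAxv, ← hc]
    ring
  have hgx : ⟪g, x⟫ = 0 := by
    simp only [hg, inner_sub_left, inner_smul_left, conj_trivial, hAxx, hxx]
    ring
  have hgg : ‖g‖ ^ 2 = 4 * (‖A x‖ ^ 2 - q ^ 2) := by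
    rw [← real_inner_self_eq_norm_sq, ← real_inner_self_eq_norm_sq]
    simp only [hg, inner_sub_left, inner_sub_right, inner_smul_left, inner_smul_right,
      conj_trivial, hAxx, hxx, ← hq]
    ring
  have hg0 : g ≠ 0 := by
    intro h
    rw [h, inner_zero_left] at hgv
    have : 0 < 2 * c * (l₁ - q) := by positivity
    linarith
  have hG : 0 < ‖g‖ := norm_pos_iff.2 hg0
  have hAx2 : ‖A x‖ ^ 2 ≤ l₁ * q :=
    norm_map_sq_le_mul_inner hsymm hpsd hl₁0
      (fun u => inner_map_le_mul_norm_sq (P := fun _ => True) (fun _ _ _ => trivial)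
        (fun u hu _ => hmax u hu) trivial) x
  have hGle : ‖g‖ ≤ l₁ := by
    refine abs_le_of_sq_le_sq' ?_ hl₁ |>.2
    nlinarith [sq_nonneg (l₁ - 2 * q)]
  have hGr : ‖g‖ ^ 2 ≤ 4 * l₁ * (l₁ - q) := by nlinarith [sq_nonneg (l₁ - q)]
  have hcs : 2 * c * (l₁ - q) ≤ ‖g‖ * √(1 - c ^ 2) := by
    have hy : ‖v₁ - c • x‖ = √(1 - c ^ 2) := by
      rw [norm_eq_sqrt_real_inner]
      simp only [inner_sub_left, inner_sub_right, inner_smul_left, inner_smul_right,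
        conj_trivial, hxx, hvv, hvx, ← hc]
      ring_nf
    have h := real_inner_le_norm g (v₁ - c • x)
    rwa [inner_sub_right, inner_smul_right, hgx, hgv, hy, mul_zero, sub_zero] at h
  have hu : -η • ((2 * q) • x - (2 : ℝ) • A x) = η • g := by
    rw [hg, neg_smul, ← smul_neg, neg_sub]
  have hx'v : ⟪x', v₁⟫ =
      c * Real.cos (η * ‖g‖) + Real.sin (η * ‖g‖) / ‖g‖ * (2 * c * (l₁ - q)) := by
    rw [hx', hu, sphereExp, if_neg (smul_ne_zero hη0.ne' hg0), norm_smul,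
      Real.norm_of_nonneg hη0.le, inner_add_left, inner_smul_left, inner_smul_left,
      inner_smul_left, hgv, ← hc]
    simp only [conj_trivial]
    field_simp
  rw [sphereDist, sphereDist, hx'v]
  exact arccos_sq_descent ha hxa hc1' hgap.le hγ hη0 hηγ hr hr0 hG hGle hGr hcs
end

section
/- (Convergence of quantized Riemannian gradient descent, iterate bound.) Let D ∈ (0, π/2), γ ≥ 2λ₁, μ = δ/2, and 0 < η ≤ cos(D)/γ with cos(D)·μ·η ≤ 1/2. Set σ = 1 − cos(D)·μ·η, K = 2/√σ, θ = √σ(1 − √σ)/4, √ξ = θK + √σ, and R⁽ᵗ⁾ = γK(√ξ)ᵗD. Let (x⁽ᵗ⁾) be a sequence of unit vectors and (q⁽ᵗ⁾) a sequence of vectors with ⟨q⁽ᵗ⁾, x⁽ᵗ⁾⟩ = 0 and η‖q⁽ᵗ⁾‖ ≤ π for all t, such that dist(x⁽⁰⁾, v₁) ≤ D, x⁽ᵗ⁺¹⁾ = exp_{x⁽ᵗ⁾}(−η·q⁽ᵗ⁾), and ‖q⁽ᵗ⁾ − grad f(x⁽ᵗ⁾)‖ ≤ θ·R⁽ᵗ⁾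 for all t. Then dist²(x⁽ᵗ⁾, v₁) ≤ ξᵗ·D² for all t ≥ 0. -/
open RealInnerProductSpace
open scoped Classical

open Real in
/-- The convex function `z ↦ cos √z` lies above its tangent lines on `[0, π²]`. -/
lemma cos_ge_cos_sub_sinc_mul {t₀ t : ℝ} (h₀ : t₀ ∈ Set.Icc 0 π) (ht : t ∈ Set.Icc 0 π) :
    cos t₀ - sinc t₀ / 2 * (t ^ 2 - t₀ ^ 2) ≤ cos t := by
  have hconc := strictConcaveOn_sin_Icc.concaveOn
  have scale : ∀ a b : ℝ, 0 ≤ a → a ≤ b → b ≤ π → sinc b * a ≤ sin a := by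
    intro a b ha hab hb
    rcases ha.eq_or_lt with rfl | ha
    · simp
    have hb0 : 0 < b := ha.trans_le hab
    have h := hconc.2 (Set.left_mem_Icc.2 pi_pos.le) (show b ∈ Set.Icc 0 π from ⟨hb0.le, hb⟩)
      (show 0 ≤ 1 - a / b by rw [sub_nonneg, div_le_one hb0]; exact hab)
      (show 0 ≤ a / b by positivity) (by ring)
    have e : a / b * b = a := by field_simp
    simp only [smul_eq_mul, mul_zero, sin_zero, zero_add, e] at h
    rw [sinc_of_ne_zero hb0.ne']
    calc sin b / b * a = a / b * sin b := by ring
      _ ≤ sin a := h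
  have hder : ∀ y : ℝ, HasDerivAt (fun y ↦ cos y + sinc t₀ / 2 * y ^ 2)
      (-sin y + sinc t₀ * y) y := by
    intro y
    have := (hasDerivAt_cos y).add (((hasDerivAt_id y).pow 2).const_mul (sinc t₀ / 2))
    refine this.congr_deriv ?_
    simp
    ring
  have hcont : Continuous (fun y ↦ cos y + sinc t₀ / 2 * y ^ 2) := by fun_prop
  rcases le_total t t₀ with h | h
  · have anti : AntitoneOn (fun y ↦ cos y + sinc t₀ / 2 * y ^ 2) (Set.Icc 0 t₀) := by
      refine antitoneOn_of_deriv_nonpos (convex_Icc _ _) hcont.continuousOn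
        (fun y _ ↦ (hder y).differentiableAt.differentiableWithinAt) fun y hy ↦ ?_
      rw [interior_Icc] at hy
      rw [(hder y).deriv]
      linarith [scale y t₀ hy.1.le hy.2.le h₀.2]
    have := anti ⟨ht.1, h⟩ (Set.right_mem_Icc.2 h₀.1) h
    simp only at this
    linarith
  · have mono : MonotoneOn (fun y ↦ cos y + sinc t₀ / 2 * y ^ 2) (Set.Icc t₀ π) := by
      refine monotoneOn_of_deriv_nonneg (convex_Icc _ _) hcont.continuousOn
        (fun y _ ↦ (hder y).differentiableAt.differentiableWithinAt) fun y hy ↦ ?_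
      rw [interior_Icc] at hy
      rw [(hder y).deriv]
      have hy0 : 0 < y := h₀.1.trans_lt hy.1
      rcases h₀.1.eq_or_lt with h0 | h0
      · rw [← h0, sinc_zero, one_mul]
        linarith [sin_le hy0.le]
      have h1 := scale t₀ y h₀.1 hy.1.le hy.2.le
      rw [sinc_of_ne_zero hy0.ne', div_mul_eq_mul_div, div_le_iff₀ hy0] at h1
      have h2 : sinc t₀ * y = sin t₀ * y / t₀ := by
        rw [sinc_of_ne_zero h0.ne']; ring
      have h3 : sin y ≤ sin t₀ * y / t₀ := (le_div_iff₀ h0).2 h1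
      linarith
    have := mono (Set.left_mem_Icc.2 h₀.2) ⟨h, ht.2⟩ h
    simp only at this
    linarith

lemma sinc_mul_self (p : ℝ) : Real.sinc p * p = Real.sin p := by
  rcases eq_or_ne p 0 with rfl | h
  · simp
  · rw [Real.sinc_of_ne_zero h, div_mul_cancel₀ _ h]

lemma sphereExp_eq_sinc {d : ℕ} (x u : EuclideanSpace ℝ (Fin d)) :
    sphereExp x u = Real.cos ‖u‖ • x + Real.sinc ‖u‖ • u := by
  unfold sphereExp
  split_ifs with h
  · simp [h]
  · rw [Real.sinc_of_ne_zero (norm_ne_zero_iff.2 h)]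

/-- The exponential map of the sphere does not increase distances. -/
lemma sphereDist_sphereExp_le {d : ℕ} {x u w : EuclideanSpace ℝ (Fin d)} (hx : ‖x‖ = 1)
    (hu : ⟪u, x⟫ = 0) (hw : ⟪w, x⟫ = 0) (huw : ‖u‖ + ‖w‖ ≤ Real.pi) :
    sphereDist (sphereExp x u) (sphereExp x w) ≤ ‖u - w‖ := by
  obtain ⟨c, hc, hc1, hc2⟩ : ∃ c : ℝ, ⟪u, w⟫ = ‖u‖ * ‖w‖ * c ∧ -1 ≤ c ∧ c ≤ 1 := by
    refine ⟨⟪u, w⟫ / (‖u‖ * ‖w‖), ?_,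
      abs_le.1 (abs_real_inner_div_norm_mul_norm_le_one u w)⟩
    rcases eq_or_ne u 0 with rfl | h1
    · simp
    rcases eq_or_ne w 0 with rfl | h2
    · simp
    have := norm_ne_zero_iff.2 h1
    have := norm_ne_zero_iff.2 h2
    field_simp
  have hinner : ⟪sphereExp x u, sphereExp x w⟫ =
      Real.cos ‖u‖ * Real.cos ‖w‖ + Real.sin ‖u‖ * Real.sin ‖w‖ * c := by
    have hw' : ⟪x, w⟫ = 0 := by rw [real_inner_comm, hw]
    rw [sphereExp_eq_sinc, sphereExp_eq_sinc]
    simp only [inner_add_left, inner_add_right, real_inner_smul_left, real_inner_smul_right,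
      real_inner_self_eq_norm_sq, hx, hu, hw', hc]
    rw [← sinc_mul_self ‖u‖, ← sinc_mul_self ‖w‖]
    ring
  have hdist : ‖u - w‖ ^ 2 = ‖u‖ ^ 2 - 2 * (‖u‖ * ‖w‖ * c) + ‖w‖ ^ 2 := by
    rw [norm_sub_sq_real, hc]
  have hle : ‖u - w‖ ≤ ‖u‖ + ‖w‖ := norm_sub_le u w
  have hp := norm_nonneg u
  have hr := norm_nonneg w
  have h₀ : ‖u - w‖ ∈ Set.Icc 0 Real.pi := ⟨norm_nonneg _, hle.trans huw⟩
  have h1 := cos_ge_cos_sub_sinc_mul h₀ (t := |‖u‖ - ‖w‖|)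
    ⟨abs_nonneg _, by rw [abs_le]; constructor <;> linarith⟩
  have h2 := cos_ge_cos_sub_sinc_mul h₀ (t := ‖u‖ + ‖w‖) ⟨by positivity, huw⟩
  rw [Real.cos_abs, Real.cos_sub, sq_abs, hdist] at h1
  rw [Real.cos_add, hdist] at h2
  have key : Real.cos ‖u - w‖ ≤ ⟪sphereExp x u, sphereExp x w⟫ := by
    rw [hinner]
    have h1' := mul_le_mul_of_nonneg_left h1 (show 0 ≤ (1 + c) / 2 by linarith)
    have h2' := mul_le_mul_of_nonneg_left h2 (show 0 ≤ (1 - c) / 2 by linarith)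
    linarith
  unfold sphereDist
  calc Real.arccos _ ≤ Real.arccos (Real.cos ‖u - w‖) := Real.arccos_le_arccos key
    _ = ‖u - w‖ := Real.arccos_cos h₀.1 h₀.2

lemma cos_sphereDist {d : ℕ} {x v : EuclideanSpace ℝ (Fin d)} (hx : ‖x‖ = 1) (hv : ‖v‖ = 1) :
    Real.cos (sphereDist x v) = ⟪x, v⟫ := by
  have h := abs_le.1 (abs_real_inner_le_norm x v)
  rw [hx, hv, one_mul] at h
  exact Real.cos_arccos h.1 h.2

/-- The logarithm map of the sphere is inverse to the exponential map, away from the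
antipodal point. -/
lemma exists_sphereLog {d : ℕ} {x v : EuclideanSpace ℝ (Fin d)} (hx : ‖x‖ = 1) (hv : ‖v‖ = 1)
    (hlt : sphereDist x v < Real.pi) :
    ∃ L : EuclideanSpace ℝ (Fin d), ‖L‖ = sphereDist x v ∧ sphereExp x L = v ∧
      Real.sinc (sphereDist x v) • L = v - Real.cos (sphereDist x v) • x ∧ ⟪L, x⟫ = 0 := by
  have hcos : Real.cos (sphereDist x v) = ⟪x, v⟫ := cos_sphereDist hx hv
  have ha0 : 0 ≤ sphereDist x v := Real.arccos_nonneg _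
  set a := sphereDist x v with ha
  have hs0 : 0 < Real.sinc a := by
    rcases ha0.eq_or_lt with h | h
    · rw [← h, Real.sinc_zero]; exact one_pos
    · rw [Real.sinc_of_ne_zero h.ne']
      exact div_pos (Real.sin_pos_of_pos_of_lt_pi h hlt) h
  have hsin : 0 ≤ Real.sin a := Real.sin_nonneg_of_nonneg_of_le_pi ha0 hlt.le
  have hnorm : ‖v - Real.cos a • x‖ = Real.sin a := by
    rw [← sq_eq_sq₀ (norm_nonneg _) hsin, norm_sub_sq_real, real_inner_smul_right,
      norm_smul, hx, hv, real_inner_comm, ← hcos, Real.sin_sq, Real.norm_eq_abs, mul_one, sq_abs]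
    ring
  have hL : Real.sinc a • ((Real.sinc a)⁻¹ • (v - Real.cos a • x)) = v - Real.cos a • x :=
    smul_inv_smul₀ hs0.ne' _
  have hn : ‖(Real.sinc a)⁻¹ • (v - Real.cos a • x)‖ = a := by
    rw [norm_smul, hnorm, Real.norm_of_nonneg (by positivity), ← sinc_mul_self]
    field_simp
  refine ⟨_, hn, ?_, hL, ?_⟩
  · rw [sphereExp_eq_sinc, hn, hL]
    abel
  · rw [real_inner_smul_left, inner_sub_left, real_inner_smul_left,
      real_inner_self_eq_norm_sq, hx, real_inner_comm, hcos]
    ring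

/-- A symmetric operator with quadratic form between `0` and `l` satisfies `A² ≤ l A`. -/
lemma norm_sq_apply_le_mul_inner {E : Type*} [NormedAddCommGroup E] [InnerProductSpace ℝ E]
    (A : E →ₗ[ℝ] E) (hsymm : ∀ u w, ⟪A u, w⟫ = ⟪u, A w⟫) (hpsd : ∀ u, 0 ≤ ⟪u, A u⟫)
    {l : ℝ} (hl : 0 ≤ l) (hle : ∀ u, ⟪u, A u⟫ ≤ l * ‖u‖ ^ 2) (u : E) :
    ‖A u‖ ^ 2 ≤ l * ⟪u, A u⟫ := by
  have h : ∀ k : ℝ, 0 ≤ k ^ 2 * ⟪u, A u⟫ - 2 * k * ‖A u‖ ^ 2 + l * ‖A u‖ ^ 2 := by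
    intro k
    have h1 := hpsd (k • u - A u)
    have h2 := hle (A u)
    have h3 : ⟪u, A (A u)⟫ = ‖A u‖ ^ 2 := by rw [← hsymm, real_inner_self_eq_norm_sq]
    simp only [map_sub, map_smul, inner_sub_left, inner_sub_right, real_inner_smul_left,
      real_inner_smul_right, h3, real_inner_self_eq_norm_sq] at h1
    linarith
  rcases hl.eq_or_lt with rfl | hl
  · have h1 := h 1
    have h2 := hle u
    linarith
  · have h1 := h l
    by_contra! hc
    nlinarith

/-- One exact Riemannian gradient step contracts the distance to the leading eigenvector, as
measured in the tangent space at `x`, and the step itself is short. -/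
lemma exact_gradient_step {d : ℕ}
    (A : EuclideanSpace ℝ (Fin d) →ₗ[ℝ] EuclideanSpace ℝ (Fin d))
    (hsymm : ∀ u w, ⟪A u, w⟫ = ⟪u, A w⟫) (hpsd : ∀ u, 0 ≤ ⟪u, A u⟫)
    {v₁ : EuclideanSpace ℝ (Fin d)} {l₁ l₂ : ℝ} (hv₁ : ‖v₁‖ = 1) (hAv₁ : A v₁ = l₁ • v₁)
    (hmax : ∀ u : EuclideanSpace ℝ (Fin d), ‖u‖ = 1 → ⟪u, A u⟫ ≤ l₁)
    (hl₂ : ∀ w : EuclideanSpace ℝ (Fin d), ‖w‖ = 1 → ⟪w, v₁⟫ = 0 → ⟪w, A w⟫ ≤ l₂)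
    (hgap : 0 < l₁ - l₂) {D η : ℝ} (hD : D < Real.pi / 2) (hη0 : 0 < η)
    (hη : 2 * l₁ * η ≤ Real.cos D)
    {x L g : EuclideanSpace ℝ (Fin d)} (hx : ‖x‖ = 1) (hxD : sphereDist x v₁ ≤ D)
    (hL : ‖L‖ = sphereDist x v₁)
    (hLv : Real.sinc (sphereDist x v₁) • L = v₁ - Real.cos (sphereDist x v₁) • x)
    (hg : g = (2 * ⟪x, A x⟫) • x - (2 : ℝ) • A x) :
    ‖-η • g - L‖ ^ 2 ≤ (1 - Real.cos D * ((l₁ - l₂) / 2) * η) * sphereDist x v₁ ^ 2 ∧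
      η * ‖g‖ ≤ Real.cos D := by
  have hcos : Real.cos (sphereDist x v₁) = ⟪x, v₁⟫ := cos_sphereDist hx hv₁
  have ha0 : 0 ≤ sphereDist x v₁ := Real.arccos_nonneg _
  set a := sphereDist x v₁ with ha
  have haD : Real.cos D ≤ Real.cos a := Real.cos_le_cos_of_nonneg_of_le_pi ha0
    (by linarith [Real.pi_pos]) hxD
  have hD0 : 0 < Real.cos D := Real.cos_pos_of_mem_Ioo ⟨by linarith [Real.pi_pos], hD⟩
  have ha_cos : 0 < Real.cos a := hD0.trans_le haD
  have homog : ∀ (l : ℝ) (u : EuclideanSpace ℝ (Fin d)),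
      (u ≠ 0 → ⟪(‖u‖⁻¹ • u), A (‖u‖⁻¹ • u)⟫ ≤ l) → ⟪u, A u⟫ ≤ l * ‖u‖ ^ 2 := by
    intro l u h
    rcases eq_or_ne u 0 with rfl | hu
    · simp
    have h1 := h hu
    have hn : 0 < ‖u‖ := norm_pos_iff.2 hu
    rw [map_smul, real_inner_smul_left, real_inner_smul_right, ← mul_assoc, ← mul_inv, ← sq,
      inv_mul_le_iff₀ (by positivity)] at h1
    linarith
  have hle : ∀ u, ⟪u, A u⟫ ≤ l₁ * ‖u‖ ^ 2 := fun u ↦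
    homog l₁ u fun hu ↦ hmax _ (norm_smul_inv_norm (𝕜 := ℝ) hu)
  have hl₁ : 0 ≤ l₁ := (hpsd v₁).trans (hmax v₁ hv₁)
  have hAxv : ⟪A x, v₁⟫ = l₁ * Real.cos a := by
    rw [hsymm, hAv₁, real_inner_smul_right, hcos]
  have hAxx : ⟪A x, x⟫ = ⟪x, A x⟫ := hsymm x x
  have hvAx : ⟪v₁, A x⟫ = l₁ * Real.cos a := by rw [real_inner_comm, hAxv]
  have hgapx : (l₁ - l₂) * Real.sin a ^ 2 ≤ l₁ - ⟪x, A x⟫ := by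
    have horth : ⟪x - Real.cos a • v₁, v₁⟫ = 0 := by
      rw [inner_sub_left, real_inner_smul_left, real_inner_self_eq_norm_sq, hv₁, hcos]
      ring
    have hz : ‖x - Real.cos a • v₁‖ ^ 2 = Real.sin a ^ 2 := by
      rw [norm_sub_sq_real, real_inner_smul_right, norm_smul, hx, hv₁, ← hcos, Real.sin_sq,
        Real.norm_eq_abs, mul_one, sq_abs]
      ring
    have h := homog l₂ (x - Real.cos a • v₁) fun hu ↦
      hl₂ _ (norm_smul_inv_norm (𝕜 := ℝ) hu) (by rw [real_inner_smul_left, horth, mul_zero])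
    rw [hz] at h
    simp only [map_sub, map_smul, hAv₁, inner_sub_left, inner_sub_right, real_inner_smul_left,
      real_inner_smul_right, real_inner_self_eq_norm_sq, hv₁, ← hcos, hvAx] at h
    linarith [congrArg (l₁ * ·) (Real.sin_sq a)]
  have hy0 := hpsd x
  have hy1 := hmax x hx
  have hn := norm_sq_apply_le_mul_inner A hsymm hpsd hl₁ hle x
  have hgn : ‖g‖ ^ 2 ≤ 4 * l₁ * (l₁ - ⟪x, A x⟫) := by
    have : ‖g‖ ^ 2 = 4 * (‖A x‖ ^ 2 - ⟪x, A x⟫ ^ 2) := by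
      rw [hg, norm_sub_sq_real, norm_smul, norm_smul, real_inner_smul_left,
        real_inner_smul_right, hx, Real.norm_eq_abs, mul_one, sq_abs, mul_pow ‖(2 : ℝ)‖]
      norm_num
      ring
    nlinarith [sq_nonneg (l₁ - ⟪x, A x⟫)]
  refine ⟨?_, ?_⟩
  · have hexp : ‖-η • g - L‖ ^ 2 = η ^ 2 * ‖g‖ ^ 2 + 2 * η * ⟪g, L⟫ + a ^ 2 := by
      rw [norm_sub_sq_real, real_inner_smul_left, norm_smul, hL, Real.norm_eq_abs, mul_pow,
        sq_abs]
      ring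
    have hgL : Real.sinc a * ⟪g, L⟫ = -2 * (l₁ - ⟪x, A x⟫) * Real.cos a := by
      rw [← real_inner_smul_right, hLv, hg]
      simp only [inner_sub_left, inner_sub_right, real_inner_smul_left, real_inner_smul_right,
        real_inner_self_eq_norm_sq, hx, ← hcos, hAxv, hAxx]
      ring
    set Δ := l₁ - ⟪x, A x⟫ with hΔ
    have hs0 : 1 / 2 ≤ Real.sinc a := by
      rcases ha0.eq_or_lt with h | h
      · rw [← h, Real.sinc_zero]; norm_num
      · rw [Real.sinc_of_ne_zero h.ne', le_div_iff₀ h]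
        have h1 := Real.mul_le_sin ha0 (hxD.trans hD.le)
        have h2 : 1 / 2 ≤ 2 / Real.pi := by
          rw [div_le_div_iff₀ two_pos Real.pi_pos]; linarith [Real.pi_le_four]
        nlinarith
    have hs1 : Real.sinc a ≤ 1 := Real.sinc_le_one a
    have hsa : Real.sin a = Real.sinc a * a := (sinc_mul_self a).symm
    have hΔ0 : 0 ≤ Δ := by rw [hΔ]; linarith
    rw [hexp]
    rw [hsa] at hgapx
    have b1 : η ^ 2 * ‖g‖ ^ 2 ≤ 2 * η * Real.cos a * Δ := by
      calc η ^ 2 * ‖g‖ ^ 2 ≤ η ^ 2 * (4 * l₁ * Δ) := by gcongr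
        _ = 2 * η * (2 * l₁ * η) * Δ := by ring
        _ ≤ 2 * η * Real.cos a * Δ := by gcongr; exact hη.trans haD
    have b2 : Real.sinc a * (η ^ 2 * ‖g‖ ^ 2 + 2 * η * ⟪g, L⟫) ≤ -(2 * η * Real.cos a * Δ) := by
      have : Real.sinc a * (η ^ 2 * ‖g‖ ^ 2) ≤ 1 * (2 * η * Real.cos a * Δ) := by gcongr
      linarith [congrArg (2 * η * ·) hgL]
    have b3 : 2 * η * Real.cos D * ((l₁ - l₂) * (Real.sinc a * a) ^ 2) ≤
        2 * η * Real.cos a * Δ := by gcongr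
    have b4 : Real.sinc a * (η ^ 2 * ‖g‖ ^ 2 + 2 * η * ⟪g, L⟫) ≤
        Real.sinc a * -(2 * η * Real.cos D * ((l₁ - l₂) * (Real.sinc a * a ^ 2))) := by
      linarith
    have b5 := le_of_mul_le_mul_left b4 (by linarith)
    have b6 : 2 * η * Real.cos D * ((l₁ - l₂) * (1 / 2 * a ^ 2)) ≤
        2 * η * Real.cos D * ((l₁ - l₂) * (Real.sinc a * a ^ 2)) := by gcongr
    have b7 : 0 ≤ η * Real.cos D * (l₁ - l₂) * a ^ 2 := by positivity
    linarith
  · have h1 : ‖g‖ ≤ 2 * l₁ := by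
      refine abs_le_of_sq_le_sq' ?_ (by positivity) |>.2
      nlinarith
    calc η * ‖g‖ ≤ η * (2 * l₁) := by gcongr
      _ = 2 * l₁ * η := by ring
      _ ≤ Real.cos D := hη

/-- convergence of quantized Riemannian gradient descent for
`f(x) = −xᵀAx` (iterate bound). With `D ∈ (0, π/2)`, `γ ≥ 2λ₁`, `μ = δ/2`,
`0 < η ≤ cos(D)/γ`, `cos(D)·μ·η ≤ 1/2`, `σ = 1 − cos(D)·μ·η`, `K = 2/√σ`,
`θ = √σ(1 − √σ)/4`, `ξ = (θK + √σ)²` (so that `√ξ = θK + √σ`), and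
`R⁽ᵗ⁾ = γK(√ξ)ᵗD`: if the unit iterates satisfy `dist(x⁽⁰⁾,v₁) ≤ D`,
`x⁽ᵗ⁺¹⁾ = exp_{x⁽ᵗ⁾}(−η q⁽ᵗ⁾)` where `⟨q⁽ᵗ⁾, x⁽ᵗ⁾⟩ = 0`, `η‖q⁽ᵗ⁾‖ ≤ π` and
`‖q⁽ᵗ⁾ − grad f(x⁽ᵗ⁾)‖ ≤ θR⁽ᵗ⁾` for all `t`, then
`dist²(x⁽ᵗ⁾,v₁) ≤ ξᵗ·D²` for all `t`. -/
theorem stmt_13 {d : ℕ} (hd : 2 ≤ d)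
    (A : EuclideanSpace ℝ (Fin d) →ₗ[ℝ] EuclideanSpace ℝ (Fin d))
    (hsymm : ∀ u w, ⟪A u, w⟫ = ⟪u, A w⟫)
    (hpsd : ∀ u, 0 ≤ ⟪u, A u⟫)
    (v₁ : EuclideanSpace ℝ (Fin d)) (l₁ l₂ : ℝ)
    (hv₁ : ‖v₁‖ = 1) (hAv₁ : A v₁ = l₁ • v₁)
    (hmax : ∀ u : EuclideanSpace ℝ (Fin d), ‖u‖ = 1 → ⟪u, A u⟫ ≤ l₁)
    (hl₂ : ∀ w : EuclideanSpace ℝ (Fin d), ‖w‖ = 1 → ⟪w, v₁⟫ = 0 → ⟪w, A w⟫ ≤ l₂)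
    (hgap : 0 < l₁ - l₂)
    (D γ η : ℝ) (hD0 : 0 < D) (hD : D < Real.pi / 2)
    (hγ : 2 * l₁ ≤ γ) (hη0 : 0 < η) (hη : η ≤ Real.cos D / γ)
    (hsmall : Real.cos D * ((l₁ - l₂) / 2) * η ≤ 1 / 2)
    (σ K θ ξ : ℝ)
    (hσ : σ = 1 - Real.cos D * ((l₁ - l₂) / 2) * η)
    (hK : K = 2 / Real.sqrt σ)
    (hθ : θ = Real.sqrt σ * (1 - Real.sqrt σ) / 4)
    (hξ : ξ = (θ * K + Real.sqrt σ) ^ 2)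
    (x : ℕ → EuclideanSpace ℝ (Fin d)) (q : ℕ → EuclideanSpace ℝ (Fin d))
    (hxu : ∀ t, ‖x t‖ = 1)
    (hqt : ∀ t, ⟪q t, x t⟫ = 0)
    (hqπ : ∀ t, η * ‖q t‖ ≤ Real.pi)
    (hx0 : sphereDist (x 0) v₁ ≤ D)
    (hstep : ∀ t, x (t + 1) = sphereExp (x t) (-η • q t))
    (herr : ∀ t, ‖q t - ((2 * ⟪x t, A (x t)⟫) • x t - (2 : ℝ) • A (x t))‖ ≤
      θ * (γ * K * Real.sqrt ξ ^ t * D)) :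
    ∀ t, sphereDist (x t) v₁ ^ 2 ≤ ξ ^ t * D ^ 2 := by
  have hcD : 0 < Real.cos D := Real.cos_pos_of_mem_Ioo ⟨by linarith [Real.pi_pos], hD⟩
  have hγ0 : 0 < γ := by
    by_contra! h
    exact absurd (hη0.trans_le hη) (not_lt.2 (div_nonpos_of_nonneg_of_nonpos hcD.le h))
  have hγη : γ * η ≤ Real.cos D := by
    rw [mul_comm]
    exact (le_div_iff₀ hγ0).1 hη
  have hη' : 2 * l₁ * η ≤ Real.cos D := (mul_le_mul_of_nonneg_right hγ hη0.le).trans hγη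
  have hcD1 : Real.cos D ≤ 1 := Real.cos_le_one D
  have hprod : 0 < Real.cos D * ((l₁ - l₂) / 2) * η := by positivity
  have hσ0 : 0 < σ := by linarith
  have hs0 : 0 < √σ := Real.sqrt_pos.2 hσ0
  have hs1 : √σ ≤ 1 := Real.sqrt_le_one.2 (by linarith)
  have hθK : θ * K = (1 - √σ) / 2 := by
    rw [hθ, hK]
    field_simp
    norm_num
  have hsξ : √ξ = (1 + √σ) / 2 := by
    rw [hξ, hθK, Real.sqrt_sq (by linarith)]
    ring
  have hcπ : Real.cos D ≤ Real.pi / 2 - D := by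
    rw [← Real.sin_pi_div_two_sub]
    exact Real.sin_le (by linarith)
  have hdist : ∀ t, sphereDist (x t) v₁ ≤ √ξ ^ t * D := by
    intro t
    induction t with
    | zero => simpa using hx0
    | succ t ih =>
      have hrD : √ξ ^ t * D ≤ D :=
        mul_le_of_le_one_left hD0.le (pow_le_one₀ (Real.sqrt_nonneg _) (by linarith))
      have haD := ih.trans hrD
      have hr0 : 0 ≤ √ξ ^ t * D := by positivity
      have ha0 : 0 ≤ sphereDist (x t) v₁ := Real.arccos_nonneg _
      obtain ⟨L, hLn, hLexp, hLv, hLx⟩ := exists_sphereLog (hxu t) hv₁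
        (by linarith [Real.pi_pos])
      obtain ⟨hc, hgs⟩ := exact_gradient_step A hsymm hpsd hv₁ hAv₁ hmax hl₂ hgap hD hη0 hη'
        (hxu t) haD hLn hLv rfl
      have he := herr t
      set g := (2 * ⟪x t, A (x t)⟫) • x t - (2 : ℝ) • A (x t)
      have hηe : η * ‖q t - g‖ ≤ (1 - √σ) / 2 * (√ξ ^ t * D) := by
        calc η * ‖q t - g‖ ≤ η * (θ * (γ * K * √ξ ^ t * D)) := by gcongr
          _ = γ * η * ((θ * K) * (√ξ ^ t * D)) := by ring
          _ ≤ 1 * ((θ * K) * (√ξ ^ t * D)) := by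
            refine mul_le_mul_of_nonneg_right (hγη.trans hcD1) (mul_nonneg ?_ hr0)
            rw [hθK]
            linarith
          _ = (1 - √σ) / 2 * (√ξ ^ t * D) := by rw [hθK, one_mul]
      have hexact : ‖-η • g - L‖ ≤ √σ * (√ξ ^ t * D) := by
        refine (abs_le_of_sq_le_sq' ?_ (mul_nonneg hs0.le ha0)).2.trans
          (mul_le_mul_of_nonneg_left ih hs0.le)
        rw [mul_pow, Real.sq_sqrt hσ0.le, hσ]
        exact hc
      have hstepnorm : ‖-η • q t‖ + ‖L‖ ≤ Real.pi := by
        have h1 : ‖q t‖ ≤ ‖q t - g‖ + ‖g‖ := norm_le_norm_sub_add _ _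
        have h2 : ‖-η • q t‖ = η * ‖q t‖ := by
          rw [norm_smul, norm_neg, Real.norm_of_nonneg hη0.le]
        rw [h2, hLn]
        have h3 : η * ‖q t‖ ≤ η * ‖q t - g‖ + η * ‖g‖ := by
          rw [← mul_add]
          gcongr
        have h4 : (1 - √σ) / 2 * (√ξ ^ t * D) ≤ 1 * (√ξ ^ t * D) := by
          gcongr
          linarith
        linarith
      have hmove := sphereDist_sphereExp_le (hxu t)
        (show ⟪-η • q t, x t⟫ = 0 by rw [real_inner_smul_left, hqt, mul_zero]) hLx hstepnorm
      rw [hLexp, ← hstep] at hmove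
      have htri : ‖-η • q t - L‖ ≤ η * ‖q t - g‖ + ‖-η • g - L‖ := by
        have : -η • q t - L = -η • (q t - g) + (-η • g - L) := by
          rw [smul_sub]
          abel
        rw [this]
        refine (norm_add_le _ _).trans_eq ?_
        rw [norm_smul, norm_neg, Real.norm_of_nonneg hη0.le]
      have hsplit : √ξ ^ (t + 1) * D =
          (1 - √σ) / 2 * (√ξ ^ t * D) + √σ * (√ξ ^ t * D) := by
        rw [pow_succ]
        linear_combination √ξ ^ t * D * hsξ
      rw [hsplit]
      linarith
  intro t
  have hξ0 : 0 ≤ ξ := hξ ▸ sq_nonneg _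
  calc sphereDist (x t) v₁ ^ 2 ≤ (√ξ ^ t * D) ^ 2 :=
        pow_le_pow_left₀ (Real.arccos_nonneg _) (hdist t) 2
    _ = ξ ^ t * D ^ 2 := by rw [mul_pow, ← pow_mul, mul_comm t 2, pow_mul, Real.sq_sqrt hξ0]
end

section
/- Let v and x* be unit vectors in ℝ^d with t := ⟨v, x*⟩ > 0, and let x̃ ∈ ℝ^d satisfy ‖x̃ − v‖ ≤ t/(2(√2 + 2)). Then x̃ ≠ 0 and the normalized initialization x⁽⁰⁾ = x̃/‖x̃‖ satisfies ⟨x⁽⁰⁾, x*⟩ ≥ t/2 = ⟨v, x*⟩/2. -/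
open RealInnerProductSpace

/-- deterministic core of the warm-start initialization.
Let `v` and `x*` be unit vectors with `t = ⟨v,x*⟩ > 0`, and let `x̃` satisfy
`‖x̃ − v‖ ≤ t/(2(√2 + 2))`. Then `x̃ ≠ 0` and the normalized initialization
`x⁽⁰⁾ = x̃/‖x̃‖` satisfies `⟨x⁽⁰⁾, x*⟩ ≥ t/2`. -/
theorem stmt_16 {d : ℕ} (v xs xt : EuclideanSpace ℝ (Fin d))
    (hv : ‖v‖ = 1) (hxs : ‖xs‖ = 1)
    (ht : 0 < ⟪v, xs⟫)
    (herr : ‖xt - v‖ ≤ ⟪v, xs⟫ / (2 * (Real.sqrt 2 + 2))) :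
    xt ≠ 0 ∧ ⟪v, xs⟫ / 2 ≤ ⟪‖xt‖⁻¹ • xt, xs⟫ := by
  set t := ⟪v, xs⟫ with ht_def
  have ht1 : t ≤ 1 := by
    simpa [hv, hxs] using real_inner_le_norm v xs
  have hsqrt : (1 : ℝ) ≤ Real.sqrt 2 := Real.one_le_sqrt.mpr (by norm_num)
  have herr6 : ‖xt - v‖ ≤ t / 6 :=
    herr.trans (div_le_div_of_nonneg_left ht.le (by norm_num) (by linarith))
  have hlower : 5 * t / 6 ≤ ⟪xt, xs⟫ := by
    have h := (abs_le.mp (abs_real_inner_le_norm (xt - v) xs)).1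
    rw [hxs, mul_one, inner_sub_left] at h
    linarith
  have hne : xt ≠ 0 := by
    rintro rfl
    rw [inner_zero_left] at hlower
    linarith
  have hnorm : ‖xt‖ ≤ 7 / 6 := by
    linarith [norm_le_norm_add_norm_sub v xt, norm_sub_rev v xt]
  refine ⟨hne, ?_⟩
  rw [real_inner_smul_left, inv_mul_eq_div, le_div_iff₀ (norm_pos_iff.mpr hne)]
  nlinarith
end

section
/- (General contraction of Riemannian gradient descent on the sphere.) Let f : ℝ^d → ℝ be differentiable, x* a unit vector, and x a unit vector with x ≠ ±x*. Let G(x) = ∇f(x) − ⟨∇f(x), x⟩x. Suppose for some a, μ, γ > 0: (i) 2a·(f(x) − f(x*)) ≤ ⟨G(x), −log_x(x*)⟩; (ii) f(x) − f(x*) ≥ (μ/2)·dist²(x, x*); (iii) f(x) − f(x*) ≥ ‖G(x)‖²/(2γ). Then for any step-size 0 < η ≤ a/γ with η‖G(x)‖ ≤ π, the gradient step x' = exp_x(−η·G(x)) satisfies dist²(x', x*) ≤ (1 − aμη)·dist²(x, x*). -/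
open RealInnerProductSpace
open scoped Classical

theorem Real.div_sin_le_div_sin {a b : ℝ} (ha : 0 < a) (hab : a ≤ b) (hb : b < Real.pi) :
    a / Real.sin a ≤ b / Real.sin b := by
  have hb0 : 0 < b := ha.trans_le hab
  have hsa := Real.sin_pos_of_pos_of_lt_pi ha (hab.trans_lt hb)
  have hsb := Real.sin_pos_of_pos_of_lt_pi hb0 hb
  have hle : a / b ≤ 1 := (div_le_one hb0).2 hab
  have key := strictConcaveOn_sin_Icc.concaveOn.2 ⟨hb0.le, hb.le⟩
    ⟨le_rfl, Real.pi_pos.le⟩ (div_pos ha hb0).le (sub_nonneg.2 hle) (add_sub_cancel _ _)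
  simp only [smul_eq_mul, Real.sin_zero, mul_zero, add_zero, div_mul_cancel₀ _ hb0.ne'] at key
  rw [div_le_div_iff₀ hsa hsb]
  rw [div_mul_eq_mul_div, div_le_iff₀ hb0] at key
  linarith

theorem Real.hasDerivAt_arccos_sq {x : ℝ} (hx : x ∈ Set.Ioo (-1 : ℝ) 1) :
    HasDerivAt (fun s => Real.arccos s ^ 2)
      (-(2 * (Real.arccos x / Real.sin (Real.arccos x)))) x := by
  refine ((Real.hasDerivAt_arccos hx.1.ne' hx.2.ne).pow 2).congr_deriv ?_
  rw [Real.sin_arccos]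
  push_cast
  ring

theorem Real.convexOn_arccos_sq :
    ConvexOn ℝ (Set.Icc (-1) 1) (fun s : ℝ => Real.arccos s ^ 2) := by
  refine MonotoneOn.convexOn_of_deriv (convex_Icc _ _)
    (Real.continuous_arccos.pow 2).continuousOn ?_ ?_
  · rw [interior_Icc]
    exact fun x hx => (Real.hasDerivAt_arccos_sq hx).differentiableAt.differentiableWithinAt
  · rw [interior_Icc]
    intro x hx y hy hxy
    rw [(Real.hasDerivAt_arccos_sq hx).deriv, (Real.hasDerivAt_arccos_sq hy).deriv]
    have := Real.div_sin_le_div_sin (Real.arccos_pos.2 hy.2)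
      (Real.antitone_arccos hxy) ((Real.arccos_lt_pi).2 hx.1)
    linarith

theorem Real.arccos_cos_sq_le (x : ℝ) : Real.arccos (Real.cos x) ^ 2 ≤ x ^ 2 := by
  rw [sq_le_sq, abs_of_nonneg (Real.arccos_nonneg _)]
  rcases le_or_gt |x| Real.pi with h | h
  · rw [← Real.cos_abs, Real.arccos_cos (abs_nonneg x) h]
  · exact (Real.arccos_le_pi _).trans h.le

/-- The spherical law of cosines compared with the Euclidean one. -/
theorem Real.arccos_sq_le_law_of_cosines (A B : ℝ) {c : ℝ} (hc : |c| ≤ 1) :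
    Real.arccos (Real.cos A * Real.cos B + c * (Real.sin A * Real.sin B)) ^ 2 ≤
      A ^ 2 + B ^ 2 - 2 * (A * B * c) := by
  obtain ⟨h₁, h₂⟩ := abs_le.1 hc
  have key := Real.convexOn_arccos_sq.2 (Real.cos_mem_Icc (A - B)) (Real.cos_mem_Icc (A + B))
    (by linarith : 0 ≤ (1 + c) / 2) (by linarith : 0 ≤ (1 - c) / 2) (by ring)
  simp only [smul_eq_mul] at key
  have hcos : (1 + c) / 2 * Real.cos (A - B) + (1 - c) / 2 * Real.cos (A + B) =
      Real.cos A * Real.cos B + c * (Real.sin A * Real.sin B) := by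
    rw [Real.cos_sub, Real.cos_add]
    ring
  rw [hcos] at key
  have e₁ := mul_le_mul_of_nonneg_left (Real.arccos_cos_sq_le (A - B))
    (by linarith : 0 ≤ (1 + c) / 2)
  have e₂ := mul_le_mul_of_nonneg_left (Real.arccos_cos_sq_le (A + B))
    (by linarith : 0 ≤ (1 - c) / 2)
  linarith

theorem sphereDist_sphereExp_sq_le {d : ℕ} {x y u : EuclideanSpace ℝ (Fin d)}
    (hx : ‖x‖ = 1) (hy : ‖y‖ = 1) (hu : ⟪u, x⟫ = 0) :
    sphereDist (sphereExp x u) y ^ 2 ≤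
      sphereDist x y ^ 2 + ‖u‖ ^ 2 - 2 * ⟪u, sphereLog x y⟫ := by
  by_cases hu0 : u = 0
  · simp [hu0, sphereExp]
  have hun : ‖u‖ ≠ 0 := norm_ne_zero_iff.2 hu0
  have hxx : ⟪x, x⟫ = 1 := by rw [real_inner_self_eq_norm_sq, hx, one_pow]
  have hyy : ⟪y, y⟫ = 1 := by rw [real_inner_self_eq_norm_sq, hy, one_pow]
  have hxy : |⟪x, y⟫| ≤ 1 := by simpa [hx, hy] using abs_real_inner_le_norm x y
  obtain ⟨hl, hr⟩ := abs_le.1 hxy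
  set w : EuclideanSpace ℝ (Fin d) := (y - x) - ⟪y - x, x⟫ • x with hw
  have huw : ⟪u, w⟫ = ⟪u, y⟫ := by
    simp [hw, inner_sub_right, inner_smul_right, hu]
  have hwn : ‖w‖ = Real.sin (sphereDist x y) := by
    rw [sphereDist, Real.sin_arccos, ← Real.sqrt_sq (norm_nonneg w),
      ← real_inner_self_eq_norm_sq]
    congr 1
    simp only [hw, inner_sub_left, inner_sub_right, inner_smul_left, inner_smul_right, hxx, hyy,
      real_inner_comm x y, RCLike.conj_to_real]
    ring
  have hlog : ⟪u, sphereLog x y⟫ = sphereDist x y * (‖w‖⁻¹ * ⟪u, w⟫) := by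
    simp only [sphereLog, sphereDist, ← hw, inner_smul_right, real_inner_comm x y]
  have key := Real.arccos_sq_le_law_of_cosines ‖u‖ (sphereDist x y)
    (abs_real_inner_div_norm_mul_norm_le_one u w)
  have hexp : ⟪sphereExp x u, y⟫ = Real.cos ‖u‖ * Real.cos (sphereDist x y) +
      ⟪u, w⟫ / (‖u‖ * ‖w‖) * (Real.sin ‖u‖ * Real.sin (sphereDist x y)) := by
    have hcos : Real.cos (sphereDist x y) = ⟪x, y⟫ := Real.cos_arccos hl hr
    simp only [sphereExp, if_neg hu0, inner_add_left, real_inner_smul_left, hcos, ← hwn, ← huw]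
    rcases eq_or_ne w 0 with h0 | h0
    · simp [h0]
    · have := norm_ne_zero_iff.2 h0
      field_simp
  rw [← hexp] at key
  have hprod : ‖u‖ * sphereDist x y * (⟪u, w⟫ / (‖u‖ * ‖w‖)) =
      sphereDist x y * (‖w‖⁻¹ * ⟪u, w⟫) := by
    field_simp
  rw [hprod, ← hlog] at key
  rw [sphereDist]
  linarith

/-- general contraction of Riemannian gradient descent on the
sphere. Let `f : ℝ^d → ℝ` be differentiable, `x*` a unit vector, `x` a unit
vector with `x ≠ ±x*`, and `G(x) = ∇f(x) − ⟨∇f(x),x⟩x`. Suppose for some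
`a, μ, γ > 0`: (i) `2a(f(x) − f(x*)) ≤ ⟨G(x), −log_x(x*)⟩`;
(ii) `f(x) − f(x*) ≥ (μ/2)·dist²(x,x*)`; (iii) `f(x) − f(x*) ≥ ‖G(x)‖²/(2γ)`.
Then for `0 < η ≤ a/γ` with `η‖G(x)‖ ≤ π`, the step `x' = exp_x(−η·G(x))`
satisfies `dist²(x',x*) ≤ (1 − aμη)·dist²(x,x*)`. -/
theorem stmt_18 {d : ℕ} (hd : 2 ≤ d)
    (f : EuclideanSpace ℝ (Fin d) → ℝ) (hf : Differentiable ℝ f)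
    (xs : EuclideanSpace ℝ (Fin d)) (hxs : ‖xs‖ = 1)
    (x : EuclideanSpace ℝ (Fin d)) (hx : ‖x‖ = 1)
    (hne : x ≠ xs) (hne' : x ≠ -xs)
    (a μ γ : ℝ) (ha : 0 < a) (hμ : 0 < μ) (hγ : 0 < γ)
    (hWQC : 2 * a * (f x - f xs) ≤
      ⟪gradient f x - ⟪gradient f x, x⟫ • x, -sphereLog x xs⟫)
    (hQG : f x - f xs ≥ μ / 2 * sphereDist x xs ^ 2)
    (hsmooth : f x - f xs ≥ ‖gradient f x - ⟪gradient f x, x⟫ • x‖ ^ 2 / (2 * γ))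
    (η : ℝ) (hη0 : 0 < η) (hη : η ≤ a / γ)
    (hηπ : η * ‖gradient f x - ⟪gradient f x, x⟫ • x‖ ≤ Real.pi)
    (x' : EuclideanSpace ℝ (Fin d))
    (hx' : x' = sphereExp x (-η • (gradient f x - ⟪gradient f x, x⟫ • x))) :
    sphereDist x' xs ^ 2 ≤ (1 - a * μ * η) * sphereDist x xs ^ 2 := by
  set G := gradient f x - ⟪gradient f x, x⟫ • x with hG
  have hGx : ⟪G, x⟫ = 0 := by
    rw [hG, inner_sub_left, real_inner_smul_left, real_inner_self_eq_norm_sq, hx]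
    ring
  have key := sphereDist_sphereExp_sq_le (u := -η • G) hx hxs
    (by rw [real_inner_smul_left, hGx, mul_zero])
  rw [← hx', real_inner_smul_left, norm_smul, Real.norm_eq_abs, mul_pow, sq_abs] at key
  rw [inner_neg_right] at hWQC
  rw [ge_iff_le, div_le_iff₀ (by positivity)] at hsmooth
  rw [le_div_iff₀ hγ] at hη
  have hΔ : 0 ≤ f x - f xs := le_trans (by positivity) hQG
  have h₁ := mul_le_mul_of_nonneg_left hWQC hη0.le
  have h₂ := mul_le_mul_of_nonneg_left hsmooth (sq_nonneg η)
  have h₃ := mul_le_mul_of_nonneg_left hη (mul_nonneg hη0.le hΔ)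
  have h₄ := mul_le_mul_of_nonneg_left hQG (mul_nonneg ha.le hη0.le)
  nlinarith
end
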